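/- arXiv:math/0608491 — 3 statements merged into one kernel-verified Lean document; each statement's English description precedes it below -/
import Mathlib

section
/- There exists a constant C > 0 such that for every prime power q and every integer n ≥ 1, the number N(q,n) of isomorphism classes of n-dimensional commutative F_q-algebras satisfies q^{(2/27)n^3 - C n^{8/3}} ≤ N(q,n) ≤ q^{(2/27)n^3 + C n^{8/3}}. -/
/-- A (commutative, associative, unital) `F`-algebra of dimension `n` as an
`F`-vector space, bundled with its carrier type. -/
structure FinDimAlg (F : Type) [CommRing F] (n : ℕ) : Type 1 where
  carrier : Type
  [commRing : CommRing carrier]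
  [algebra : Algebra F carrier]
  finrank_eq : Module.finrank F carrier = n

attribute [instance] FinDimAlg.commRing FinDimAlg.algebra

/-- Two bundled algebras are isomorphic when there is an `F`-algebra isomorphism
between them. -/
def FinDimAlg.Iso {F : Type} [CommRing F] {n : ℕ} (A B : FinDimAlg F n) : Prop :=
  Nonempty (A.carrier ≃ₐ[F] B.carrier)

/-- The number of isomorphism classes of `n`-dimensional `F`-algebras. -/
noncomputable def algCount (F : Type) [CommRing F] (n : ℕ) : ℕ :=
  Nat.card (Quot (FinDimAlg.Iso (F := F) (n := n)))

theorem aux_mult {F A B ι τ κ : Type} [Field F] [CommRing A] [CommRing B] [Algebra F A] [Algebra F B]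
    [Finite τ]
    (φ : A ≃ₗ[F] B) (h1 : φ 1 = 1) (g : ι → A) (g' : ι → B) (hg : ∀ k x, φ (g k * x) = g' k * φ x)
    (y : τ → A) (y' : τ → B) (hy : ∀ k x, φ (y k * x) = y' k * φ x) (hnil : ∀ k, IsNilpotent (y' k))
    (hI : ∀ a, a ∈ Ideal.span (Set.range y) ↔ φ a ∈ Ideal.span (Set.range y'))
    (u ν : κ → A) (hν : ∀ i x, φ (ν i * x) - φ (ν i) * φ x ∈ Ideal.span (Set.range y'))
    (hu : ∀ i, u i - ν i ∈ Algebra.adjoin F (Set.range g))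
    (hspan : ∀ a, ∃ v ∈ Submodule.span F (Set.range u), a - v ∈ Ideal.span (Set.range y))
    (huu : ∀ i j, φ (u i * u j) - φ (u i) * φ (u j) ∈ Ideal.span (Set.range y') →
      φ (u i * u j) = φ (u i) * φ (u j)) (a b : A) : φ (a * b) = φ a * φ b := by
  set I := Ideal.span (Set.range y) with hIdef
  set I' := Ideal.span (Set.range y') with hI'def
  let S : Subalgebra F A :=
    { carrier := {a | ∀ x, φ (a * x) - φ a * φ x ∈ I'}
      mul_mem' := by
        intro a b ha hb x
        have e1 := ha (b * x)
        have e2 := I'.mul_mem_left (φ a) (hb x)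
        have e3 := I'.mul_mem_left (φ x) (ha b)
        have := I'.sub_mem (I'.add_mem e1 e2) e3
        convert this using 1
        rw [mul_assoc]; ring
      add_mem' := by
        intro a b ha hb x
        have := I'.add_mem (ha x) (hb x)
        convert this using 1
        rw [add_mul, map_add, map_add]; ring
      algebraMap_mem' := by
        intro r x
        rw [Algebra.algebraMap_eq_smul_one, smul_mul_assoc, one_mul, map_smul, map_smul, h1,
          smul_mul_assoc, one_mul, sub_self]
        exact I'.zero_mem }
  have hgS : Algebra.adjoin F (Set.range g) ≤ S := by
    apply Algebra.adjoin_le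
    rintro _ ⟨k, rfl⟩ x
    have : φ (g k) = g' k := by
      have := hg k 1
      rwa [mul_one, h1, mul_one] at this
    rw [hg, this, sub_self]
    exact I'.zero_mem
  have hIS : ∀ a ∈ I, a ∈ S := by
    intro a ha x
    exact I'.sub_mem ((hI _).1 (I.mul_mem_right _ ha)) (I'.mul_mem_right _ ((hI _).1 ha))
  have huS : ∀ i, u i ∈ S := by
    intro i
    have := S.add_mem (hgS (hu i)) (show ν i ∈ S from hν i)
    rwa [sub_add_cancel] at this
  have hS : ∀ a, a ∈ S := by
    intro a
    obtain ⟨v, hv, hav⟩ := hspan a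
    have hv' : v ∈ S := by
      have : Submodule.span F (Set.range u) ≤ Subalgebra.toSubmodule S := by
        rw [Submodule.span_le]
        rintro _ ⟨i, rfl⟩
        exact huS i
      exact this hv
    have := S.add_mem (hIS _ hav) hv'
    rwa [sub_add_cancel] at this
  have huu' : ∀ i j, φ (u i * u j) = φ (u i) * φ (u j) := fun i j => huu i j (hS (u i) (u j))
  have hvv : ∀ v ∈ Submodule.span F (Set.range u), ∀ w ∈ Submodule.span F (Set.range u),
      φ (v * w) = φ v * φ w := by
    intro v hv w hw
    induction hv using Submodule.span_induction with
    | mem x hx =>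
      obtain ⟨i, rfl⟩ := hx
      induction hw using Submodule.span_induction with
      | mem x hx =>
        obtain ⟨j, rfl⟩ := hx
        exact huu' i j
      | zero => simp
      | add p q _ _ hp hq => simp only [mul_add, map_add, hp, hq]
      | smul r p _ hp => simp only [mul_smul_comm, map_smul, hp]
    | zero => simp
    | add p q _ _ hp hq => simp only [add_mul, map_add, hp, hq]
    | smul r p _ hp => simp only [smul_mul_assoc, map_smul, hp]
  have key : ∀ k : ℕ, ∀ a b, φ (a * b) - φ a * φ b ∈ I' ^ k := by
    intro k
    induction k with
    | zero => intro a b; simp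
    | succ k ih =>
      have hW : ∀ w ∈ I, ∀ b, φ (w * b) - φ w * φ b ∈ I' ^ (k+1) := by
        intro w hw
        induction hw using Submodule.span_induction with
        | zero => intro b; simp
        | add p q _ _ hp hq =>
          intro b
          convert (I' ^ (k+1)).add_mem (hp b) (hq b) using 1
          rw [add_mul, map_add, map_add]; ring
        | mem x hx =>
          obtain ⟨j, rfl⟩ := hx
          intro b
          have := hy j 1
          rw [mul_one, h1, mul_one] at this
          rw [hy, this, sub_self]; exact Ideal.zero_mem _
        | smul r p hp' hp =>
          intro b
          clear hp
          induction hp' using Submodule.span_induction generalizing r with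
          | zero => simp
          | add p q _ _ hp hq =>
            convert (I' ^ (k+1)).add_mem (hp r) (hq r) using 1
            rw [smul_add, add_mul, map_add, map_add]; ring
          | mem x hx =>
            obtain ⟨j, rfl⟩ := hx
            have e : φ (r • y j * b) - φ (r • y j) * φ b = y' j * (φ (r * b) - φ r * φ b) := by
              have e1 : r • y j * b = y j * (r * b) := by rw [smul_eq_mul]; ring
              have e2 : r • y j = y j * r := by rw [smul_eq_mul]; ring
              rw [e1, e2, hy, hy]; ring
            rw [e, pow_succ']
            exact Ideal.mul_mem_mul (Ideal.subset_span ⟨j, rfl⟩) (ih r b)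
          | smul t p _ hp =>
            have := hp (r * t)
            rwa [mul_smul] at this
      intro a b
      obtain ⟨v, hv, hav⟩ := hspan a
      obtain ⟨w, hw, hbw⟩ := hspan b
      have e1 := hW _ hav b
      have e2 := hW _ hbw v
      have e3 := hvv v hv w hw
      convert (I' ^ (k+1)).add_mem e1 e2 using 1
      rw [sub_mul, sub_mul, mul_comm w v]
      simp only [map_sub, e3]
      rw [mul_comm b v]; ring
  have hn : IsNilpotent I' := by
    rw [Ideal.FG.isNilpotent_iff_le_nilradical ⟨(Set.finite_range y').toFinset, by simp [hI'def]⟩]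
    rw [hI'def, Ideal.span_le]
    rintro _ ⟨k, rfl⟩
    exact hnil k
  obtain ⟨k, hk⟩ := hn
  have := key k a b
  rw [hk] at this
  exact sub_eq_zero.1 this

theorem pi_gen {F ι : Type} [Field F] [Finite ι] (K : ι → Type) [∀ i, Field (K i)] [∀ i, Finite (K i)]
    [∀ i, Algebra F (K i)] (s : ℕ) (hs : Nat.card ι ≤ 2 ^ s) :
    ∃ g : Option (Fin s) → ∀ i, K i, Algebra.adjoin F (Set.range g) = ⊤ := by
  classical
  have := Fintype.ofFinite ι
  have hemb : Nonempty (ι ↪ (Fin s → Bool)) := by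
    apply Function.Embedding.nonempty_of_card_le
    rw [Nat.card_eq_fintype_card] at hs
    simpa using hs
  obtain ⟨β⟩ := hemb
  choose z hz using fun i => IsCyclic.exists_generator (α := (K i)ˣ)
  let g : Option (Fin s) → ∀ i, K i := fun o =>
    match o with
    | none => fun i => (z i : K i)
    | some k => fun i => if β i k then 1 else 0
  refine ⟨g, ?_⟩
  set S := Algebra.adjoin F (Set.range g)
  have hgS : ∀ o, g o ∈ S := fun o => Algebra.subset_adjoin ⟨o, rfl⟩
  have h1 : ∀ i, (Pi.single i 1 : ∀ i, K i) ∈ S := by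
    intro i
    have : (Pi.single i 1 : ∀ i, K i) = ∏ k : Fin s, (if β i k then g (some k) else 1 - g (some k)) := by
      ext j
      rw [Finset.prod_apply]
      by_cases hij : j = i
      · subst hij
        rw [Pi.single_eq_same]
        symm
        apply Finset.prod_eq_one
        intro k _
        by_cases hb : β j k <;> simp [hb, g]
      · rw [Pi.single_eq_of_ne hij]
        symm
        have : ∃ k, β i k ≠ β j k := by
          by_contra hcon
          push Not at hcon
          exact hij (β.injective (funext hcon)).symm
        obtain ⟨k, hk⟩ := this
        apply Finset.prod_eq_zero (Finset.mem_univ k)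
        by_cases hb : β i k
        · have : β j k = false := by
            cases h : β j k
            · rfl
            · rw [hb, h] at hk; exact absurd rfl hk
          simp [hb, g, this]
        · have : β j k = true := by
            cases h : β j k
            · simp at hb; rw [hb, h] at hk; exact absurd rfl hk
            · rfl
          simp [hb, g, this]
    rw [this]
    apply S.prod_mem
    intro k _
    split_ifs
    · exact hgS (some k)
    · exact S.sub_mem S.one_mem (hgS (some k))
  have h2 : ∀ i (x : K i), (Pi.single i x : ∀ i, K i) ∈ S := by
    intro i x
    by_cases hx : x = 0
    · subst hx; simp
    · obtain ⟨k, hk⟩ := (Submonoid.mem_powers_iff _ _).1 (mem_powers_iff_mem_zpowers.2 (hz i (Units.mk0 x hx)))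
      have : (Pi.single i x : ∀ i, K i) = Pi.single i 1 * g none ^ k := by
        ext j
        by_cases hij : j = i
        · subst hij
          have := congrArg Units.val hk
          simp at this
          simp [g, this]
        · simp [Pi.single_eq_of_ne hij]
      rw [this]
      exact S.mul_mem (h1 i) (S.pow_mem (hgS none) _)
  rw [eq_top_iff]
  rintro x -
  rw [← Finset.univ_sum_single x]
  exact S.sum_mem fun i _ => h2 i _

theorem nil_gen {F A : Type} [Field F] [Finite F] [CommRing A] [Algebra F A] [Module.Finite F A]
    (s : ℕ) (hs : Module.finrank F A ≤ 2 ^ s) :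
    ∃ g : Option (Fin s) → A, ∀ a, ∃ c ∈ Algebra.adjoin F (Set.range g), IsNilpotent (a - c) := by
  classical
  have hfin : Finite A := Module.finite_of_finite F
  have : IsArtinianRing A := inferInstance
  let K : MaximalSpectrum A → Type := fun I => A ⧸ I.asIdeal
  let _ : ∀ I, Field (K I) := fun I => @Ideal.Quotient.field A _ I.asIdeal I.isMaximal
  let _ : ∀ I, Algebra F (K I) := fun I => inferInstanceAs (Algebra F (A ⧸ I.asIdeal))
  have : ∀ I, Finite (K I) := fun I => Finite.of_surjective _ (Ideal.Quotient.mk_surjective (I := I.asIdeal))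
  have : ∀ I, Module.Finite F (K I) := fun I => Module.Finite.of_finite
  have := Fintype.ofFinite (MaximalSpectrum A)
  let π : A →ₐ[F] (∀ I, K I) := AlgHom.pi fun I => Ideal.Quotient.mkₐ F I.asIdeal
  have hπ : Function.Surjective π := by
    intro x
    obtain ⟨z, hz⟩ := (IsArtinianRing.quotNilradicalEquivPi A).surjective x
    obtain ⟨a, rfl⟩ := Ideal.Quotient.mk_surjective z
    refine ⟨a, ?_⟩
    rw [← hz]
    rfl
  have hker : ∀ a, π a = 0 → IsNilpotent a := by
    intro a ha
    have h1 : IsArtinianRing.quotNilradicalEquivPi A (Ideal.Quotient.mk _ a) = 0 := by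
      rw [← ha]; rfl
    rw [map_eq_zero_iff _ (IsArtinianRing.quotNilradicalEquivPi A).injective,
      Ideal.Quotient.eq_zero_iff_mem] at h1
    exact h1
  have hcard : Nat.card (MaximalSpectrum A) ≤ 2 ^ s := by
    refine le_trans ?_ hs
    refine le_trans ?_ (LinearMap.finrank_le_finrank_of_surjective (f := π.toLinearMap) hπ)
    rw [Module.finrank_pi_fintype, Nat.card_eq_fintype_card, ← Finset.card_univ,
      Finset.card_eq_sum_ones]
    apply Finset.sum_le_sum
    intro I _
    exact Module.finrank_pos
  obtain ⟨g, hg⟩ := pi_gen (F := F) K s hcard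
  choose g' hg' using fun o => hπ (g o)
  refine ⟨g', fun a => ?_⟩
  have : π a ∈ (Algebra.adjoin F (Set.range g')).map π := by
    rw [AlgHom.map_adjoin, ← Set.range_comp]
    have : π ∘ g' = g := funext hg'
    rw [this, hg]
    trivial
  obtain ⟨c, hc, hca⟩ := this
  refine ⟨c, hc, hker _ ?_⟩
  rw [map_sub]
  exact sub_eq_zero.2 hca.symm

theorem finrank_ext {F A M : Type} [Field F] [AddCommGroup A] [Module F A] [Module.Finite F A]
    [AddCommGroup M] [Module F M]
    (W W' : Submodule F A) (h : W ≤ W') (f : A →ₗ[F] A) (hf : LinearMap.range f ≤ W') :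
    Module.finrank F (LinearMap.range (W.mkQ ∘ₗ f)) + Module.finrank F W ≤ Module.finrank F W' := by
  have e := (W.mkQ.domRestrict W').finrank_range_add_finrank_ker
  have e2 : LinearMap.ker (W.mkQ.domRestrict W') = W.comap W'.subtype := by
    ext x; simp
  rw [e2, (Submodule.comapSubtypeEquivOfLe h).finrank_eq] at e
  rw [← e]
  have : LinearMap.range (W.mkQ ∘ₗ f) ≤ LinearMap.range (W.mkQ.domRestrict W') := by
    rintro _ ⟨x, rfl⟩
    exact ⟨⟨f x, hf ⟨x, rfl⟩⟩, rfl⟩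
  have := Submodule.finrank_mono this
  omega

theorem greedy {F A : Type} [Field F] [CommRing A] [Algebra F A] [Module.Finite F A]
    (s : ℕ) (hs : Module.finrank F A ≤ s * s) :
    ∃ y : Fin s → A, (∀ k, IsNilpotent (y k)) ∧ ∀ z, IsNilpotent z →
      Module.finrank F (LinearMap.range
        (((Ideal.span (Set.range y)).restrictScalars F).mkQ ∘ₗ LinearMap.mulLeft F z)) ≤ s := by
  classical
  by_contra hcon
  push Not at hcon
  have key : ∀ k ≤ s, ∃ y : Fin s → A, (∀ i, IsNilpotent (y i)) ∧ (∀ i : Fin s, k ≤ i → y i = 0) ∧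
      k * (s + 1) ≤ Module.finrank F ((Ideal.span (Set.range y)).restrictScalars F) := by
    intro k
    induction k with
    | zero => exact fun _ => ⟨0, by simp, by simp, by simp⟩
    | succ k ih =>
      intro hk
      obtain ⟨y, hy, hy0, hdim⟩ := ih (by omega)
      obtain ⟨z, hz, hrk⟩ := hcon y hy
      refine ⟨Function.update y ⟨k, hk⟩ z, ?_, ?_, ?_⟩
      · intro i
        by_cases hi : i = ⟨k, hk⟩
        · subst hi; simpa using hz
        · simpa [hi] using hy i
      · intro i hi
        have : i ≠ ⟨k, hk⟩ := by rintro rfl; simp at hi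
        simp only [Function.update_of_ne this]
        exact hy0 i (by omega)
      · have := finrank_ext (M := A) ((Ideal.span (Set.range y)).restrictScalars F)
          ((Ideal.span (Set.range (Function.update y ⟨k, hk⟩ z))).restrictScalars F) ?_
          (LinearMap.mulLeft F z) ?_
        · rw [Nat.succ_mul]; omega
        · intro x hx
          rw [Submodule.restrictScalars_mem] at hx ⊢
          revert x
          change Ideal.span _ ≤ _
          rw [Ideal.span_le]
          rintro _ ⟨i, rfl⟩
          by_cases hi : i = ⟨k, hk⟩
          · subst hi; rw [hy0 _ (le_refl _)]; exact Submodule.zero_mem _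
          · exact Ideal.subset_span ⟨i, by simp [hi]⟩
        · rintro _ ⟨x, rfl⟩
          rw [Submodule.restrictScalars_mem]
          exact Ideal.mul_mem_right _ _ (Ideal.subset_span ⟨⟨k, hk⟩, by simp⟩)
  obtain ⟨y, hy, -, hdim⟩ := key s le_rfl
  obtain ⟨z, hz, hrk⟩ := hcon y hy
  have := finrank_ext (M := A) ((Ideal.span (Set.range y)).restrictScalars F) ⊤ le_top
    (LinearMap.mulLeft F z) le_top
  rw [finrank_top] at this
  nlinarith

theorem low_rank {F V M : Type} [Field F] [AddCommGroup V] [Module F V] [Module.Finite F V]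
    [AddCommGroup M] [Module F M] (s : ℕ) (f : V →ₗ[F] M)
    (hf : Module.finrank F (LinearMap.range f) ≤ s) :
    ∃ (P : V →ₗ[F] (Fin s → F)) (Q : (Fin s → F) →ₗ[F] M), ∀ x, f x = Q (P x) := by
  obtain ⟨j, hj⟩ : ∃ j : LinearMap.range f →ₗ[F] (Fin s → F), Function.Injective j := by
    let b := Module.finBasis F (LinearMap.range f)
    refine ⟨(LinearMap.funLeft F F (fun i : Fin s => i)) ∘ₗ
      (Function.ExtendByZero.linearMap F (Fin.castLE hf)) ∘ₗ b.equivFun.toLinearMap, ?_⟩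
    intro x y hxy
    apply b.equivFun.injective
    ext i
    have := congrFun hxy (Fin.castLE hf i)
    simpa [LinearMap.funLeft, (Fin.castLE_injective hf).extend_apply] using this
  obtain ⟨l, hl⟩ := LinearMap.exists_leftInverse_of_injective j (LinearMap.ker_eq_bot.2 hj)
  refine ⟨j ∘ₗ f.rangeRestrict, (LinearMap.range f).subtype ∘ₗ l, fun x => ?_⟩
  have := LinearMap.congr_fun hl (f.rangeRestrict x)
  simp only [LinearMap.comp_apply, LinearMap.id_apply] at this ⊢
  rw [this]; rfl

abbrev CV (F : Type) (n w : ℕ) : Type := (Fin (n - w) → F) × (Fin w → F)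

abbrev CCode (F : Type) [Field F] (n s w : ℕ) : Type :=
  CV F n w × (Option (Fin (2 * s)) → CV F n w →ₗ[F] CV F n w) × (Fin s → CV F n w →ₗ[F] CV F n w) ×
  (Fin (n - w) → CV F n w) × (Fin (n - w) → CV F n w →ₗ[F] (Fin s → F)) ×
  (Fin (n - w) → (Fin s → F) →ₗ[F] (Fin (n - w) → F)) × (Sym2 (Fin (n - w)) → Fin w → F)

def cu (F : Type) [Field F] (n w : ℕ) (i : Fin (n - w)) : CV F n w := (Pi.single i 1, 0)

structure Realizes {F : Type} [Field F] {n s w : ℕ} (A : Type) [CommRing A] [Algebra F A]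
    (e : A ≃ₗ[F] CV F n w) (c : CCode F n s w) : Prop where
  one : e 1 = c.1
  gen : ∃ g : Option (Fin (2 * s)) → A, (∀ k x, e (g k * x) = c.2.1 k (e x)) ∧
    ∀ i, e.symm (cu F n w i) - e.symm (c.2.2.2.1 i) ∈ Algebra.adjoin F (Set.range g)
  nil : ∃ y : Fin s → A, (∀ k, IsNilpotent (y k)) ∧ (∀ k x, e (y k * x) = c.2.2.1 k (e x)) ∧
    ∀ a, a ∈ Ideal.span (Set.range y) ↔ (e a).1 = 0
  low : ∀ i x, (e (e.symm (c.2.2.2.1 i) * x)).1 = c.2.2.2.2.2.1 i (c.2.2.2.2.1 i (e x))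
  top : ∀ i j, (e (e.symm (cu F n w i) * e.symm (cu F n w j))).2 = c.2.2.2.2.2.2 s(i, j)

theorem Realizes.iso {F : Type} [Field F] {n s w : ℕ} {A B : Type} [CommRing A] [Algebra F A]
    [CommRing B] [Algebra F B] {e : A ≃ₗ[F] CV F n w} {e' : B ≃ₗ[F] CV F n w} {c : CCode F n s w}
    (hA : Realizes A e c) (hB : Realizes B e' c) : Nonempty (A ≃ₐ[F] B) := by
  obtain ⟨g, hg, hgu⟩ := hA.gen
  obtain ⟨g', hg', -⟩ := hB.gen
  obtain ⟨y, -, hy, hyI⟩ := hA.nil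
  obtain ⟨y', hyn', hy', hyI'⟩ := hB.nil
  let φ : A ≃ₗ[F] B := e.trans e'.symm
  have hφ : ∀ a, e' (φ a) = e a := fun a => by simp [φ]
  have hφs : ∀ v, φ (e.symm v) = e'.symm v := fun a => by simp [φ]
  have h1 : φ 1 = 1 := by
    apply e'.injective
    rw [hφ, hA.one, hB.one]
  refine ⟨AlgEquiv.ofLinearEquiv φ h1 ?_⟩
  apply aux_mult φ h1 g g' ?_ y y' ?_ hyn' ?_ (fun i => e.symm (cu F n w i))
    (fun i => e.symm (c.2.2.2.1 i)) ?_ hgu ?_ ?_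
  · intro k x
    apply e'.injective
    rw [hφ, hg, hg', hφ]
  · intro k x
    apply e'.injective
    rw [hφ, hy, hy', hφ]
  · intro a
    rw [hyI, hyI', hφ]
  · intro i x
    rw [hyI', map_sub, Prod.fst_sub, hφ, hA.low, hφs, hB.low, hφ, sub_self]
  · intro a
    refine ⟨e.symm ((e a).1, 0), ?_, ?_⟩
    · have : e.symm ((e a).1, 0) = ∑ i, (e a).1 i • e.symm (cu F n w i) := by
        simp only [← map_smul, ← map_sum]
        congr 1
        ext j
        · simp [cu, Prod.fst_sum, Finset.sum_apply, Pi.single_apply]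
        · simp [cu, Prod.snd_sum]
      rw [this]
      exact Submodule.sum_mem _ fun i _ => Submodule.smul_mem _ _ (Submodule.subset_span ⟨i, rfl⟩)
    · rw [hyI]; simp
  · intro i j hij
    rw [hyI', map_sub, Prod.fst_sub, sub_eq_zero] at hij
    apply e'.injective
    apply Prod.ext hij
    rw [hφ, hA.top, hφs, hφs, hB.top]

theorem exists_realizes {F : Type} [Field F] [Finite F] (A : Type) [CommRing A] [Algebra F A]
    [Module.Finite F A] {n s : ℕ} (hn : Module.finrank F A = n) (hs : n ≤ s * s) :
    ∃ w : Fin (n + 1), ∃ (e : A ≃ₗ[F] CV F n w) (c : CCode F n s w), Realizes A e c := by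
  have hs2 : Module.finrank F A ≤ 2 ^ (2 * s) := by
    rw [hn, two_mul, pow_add]
    exact hs.trans (Nat.mul_le_mul Nat.lt_two_pow_self.le Nat.lt_two_pow_self.le)
  obtain ⟨g, hg⟩ := nil_gen (F := F) (A := A) (2 * s) hs2
  obtain ⟨y, hy, hyr⟩ := greedy (F := F) (A := A) s (hn ▸ hs)
  let W : Submodule F A := (Ideal.span (Set.range y)).restrictScalars F
  obtain ⟨U, hU⟩ := W.exists_isCompl
  have hUW := Submodule.finrank_add_eq_of_isCompl hU
  have hw : Module.finrank F W < n + 1 := by omega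
  obtain ⟨w, hwW⟩ : ∃ w : Fin (n + 1), (w : ℕ) = Module.finrank F W := ⟨⟨_, hw⟩, rfl⟩
  have e1 : U ≃ₗ[F] (Fin (n - w) → F) := LinearEquiv.ofFinrankEq _ _ (by simp; omega)
  have e2 : W ≃ₗ[F] (Fin w → F) := LinearEquiv.ofFinrankEq _ _ (by simp; omega)
  let e : A ≃ₗ[F] CV F n w :=
    (Submodule.prodEquivOfIsCompl U W hU.symm).symm.trans (e1.prodCongr e2)
  have he : ∀ a, a ∈ Ideal.span (Set.range y) ↔ (e a).1 = 0 := by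
    intro a
    have : (e a).1 = e1 ((Submodule.prodEquivOfIsCompl U W hU.symm).symm a).1 := rfl
    rw [this, LinearEquiv.map_eq_zero_iff, Submodule.prodEquivOfIsCompl_symm_apply_fst_eq_zero]
    rfl
  choose d hd hdn using hg
  let ν : Fin (n - w) → A := fun i => e.symm (cu F n w i) - d (e.symm (cu F n w i))
  have hPQ : ∀ i, ∃ (P : CV F n w →ₗ[F] (Fin s → F)) (Q : (Fin s → F) →ₗ[F] (Fin (n - w) → F)),
      ∀ x, (e (ν i * x)).1 = Q (P (e x)) := by
    intro i
    let f : A →ₗ[F] (Fin (n - w) → F) := LinearMap.fst F _ _ ∘ₗ e.toLinearMap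
    have hWf : W ≤ LinearMap.ker f := fun a ha => (he a).1 ha
    have hf : f ∘ₗ LinearMap.mulLeft F (ν i) =
        W.liftQ f hWf ∘ₗ (W.mkQ ∘ₗ LinearMap.mulLeft F (ν i)) := by
      rw [← LinearMap.comp_assoc, Submodule.liftQ_mkQ]
    obtain ⟨P, Q, h⟩ := low_rank s (f ∘ₗ LinearMap.mulLeft F (ν i)) (by
      rw [hf, LinearMap.range_comp]
      exact (Submodule.finrank_map_le _ _).trans (hyr (ν i) (hdn _)))
    refine ⟨P ∘ₗ e.symm.toLinearMap, Q, fun x => ?_⟩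
    have := h x
    simp only [LinearMap.comp_apply, LinearEquiv.coe_coe, LinearEquiv.symm_apply_apply]
    rw [← this]
    rfl
  choose P Q hPQ using hPQ
  refine ⟨w, e, ⟨e 1, fun k => e.toLinearMap ∘ₗ LinearMap.mulLeft F (g k) ∘ₗ e.symm.toLinearMap,
    fun k => e.toLinearMap ∘ₗ LinearMap.mulLeft F (y k) ∘ₗ e.symm.toLinearMap,
    fun i => e (ν i), P, Q, Sym2.lift ⟨fun i j =>
      (e (e.symm (cu F n w i) * e.symm (cu F n w j))).2, fun i j => by
        simp only [mul_comm]⟩⟩, ?_⟩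
  constructor
  · rfl
  · refine ⟨g, fun k x => by simp, fun i => ?_⟩
    simp only [LinearEquiv.symm_apply_apply, ν, sub_sub_cancel]
    exact hd _
  · exact ⟨y, hy, fun k x => by simp, he⟩
  · intro i x
    simp only [LinearEquiv.symm_apply_apply]
    exact hPQ i x
  · intro i j
    rfl

theorem finite_lin (F V M : Type) [Field F] [Finite F] [AddCommGroup V] [Module F V]
    [AddCommGroup M] [Module F M] [Module.Finite F V] [Module.Finite F M] : Finite (V →ₗ[F] M) :=
  Module.finite_of_finite F

theorem card_lin (F V M : Type) [Field F] [Finite F] [AddCommGroup V] [Module F V]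
    [AddCommGroup M] [Module F M] [Module.Finite F V] [Module.Finite F M] : Nat.card (V →ₗ[F] M) =
    Nat.card F ^ (Module.finrank F V * Module.finrank F M) := by
  rw [Module.natCard_eq_pow_finrank (K := F), Module.finrank_linearMap]

instance (F : Type) [Field F] [Finite F] (n s w : ℕ) : Finite (CCode F n s w) := by
  have h1 := finite_lin F (CV F n w) (CV F n w)
  have h2 := finite_lin F (CV F n w) (Fin s → F)
  have h3 := finite_lin F (Fin s → F) (Fin (n - w) → F)
  infer_instance

theorem card_code (F : Type) [Field F] [Finite F] (n s w : ℕ) (hw : w ≤ n) : Nat.card (CCode F n s w) =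
    Nat.card F ^ (n + (2 * s + 1) * (n * n) + s * (n * n) + (n - w) * n + (n - w) * (n * s) +
      (n - w) * (s * (n - w)) + (n - w + 1).choose 2 * w) := by
  have hV : Module.finrank F (CV F n w) = n := by simp; omega
  have hV' : Nat.card (CV F n w) = Nat.card F ^ n := by
    rw [Module.natCard_eq_pow_finrank (K := F), hV]
  simp only [CCode]
  simp only [Nat.card_prod _ (_ × _), Nat.card_fun, card_lin, hV, hV', Module.finrank_fin_fun,
    Nat.card_fin, Nat.card_eq_fintype_card (α := Option (Fin _)),
    Nat.card_eq_fintype_card (α := Sym2 (Fin _)), Sym2.card, Fintype.card_option, Fintype.card_fin]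
  rw [Nat.card_prod]
  simp only [Nat.card_fun, card_lin, hV, hV', Module.finrank_fin_fun,
    Nat.card_fin, Nat.card_eq_fintype_card (α := Option (Fin _)),
    Nat.card_eq_fintype_card (α := Sym2 (Fin _)), Sym2.card, Fintype.card_option, Fintype.card_fin,
    ← pow_mul, ← pow_add]
  congr 1
  ring

theorem algCount_code (F : Type) [Field F] [Finite F] (n s : ℕ) (hn : 1 ≤ n) (hs : n ≤ s * s) :
    Finite (Quot (FinDimAlg.Iso (F := F) (n := n))) ∧
    algCount F n ≤ ∑ w : Fin (n + 1), Nat.card (CCode F n s w) := by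
  have h : ∀ A : FinDimAlg F n, ∃ w : Fin (n + 1), ∃ (e : A.carrier ≃ₗ[F] CV F n w)
      (c : CCode F n s w), Realizes A.carrier e c := by
    intro A
    have : Module.Finite F A.carrier := Module.finite_of_finrank_pos (by rw [A.finrank_eq]; omega)
    exact exists_realizes A.carrier A.finrank_eq hs
  choose w e c hc using h
  let f : Quot (FinDimAlg.Iso (F := F) (n := n)) → Σ w : Fin (n + 1), CCode F n s w :=
    fun x => ⟨w x.out, c x.out⟩
  have hf : Function.Injective f := by
    intro x z hxz
    rw [← Quot.out_eq x, ← Quot.out_eq z]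
    apply Quot.sound
    have key : ∀ A B : FinDimAlg F n, (⟨w A, c A⟩ : Σ w : Fin (n + 1), CCode F n s w) = ⟨w B, c B⟩ →
        A.Iso B := by
      intro A B hAB
      have h1 := hc A
      have h2 := hc B
      generalize e A = eA at h1
      generalize e B = eB at h2
      generalize c A = cA at *
      generalize c B = cB at *
      generalize w A = wA at *
      generalize w B = wB at *
      cases hAB
      exact h1.iso h2
    exact key _ _ hxz
  refine ⟨Finite.of_injective f hf, ?_⟩
  rw [← Nat.card_sigma]
  exact Nat.card_le_card_of_injective f hf

def LM (F : Type) (d r : ℕ) (_ : Sym2 (Fin d) → Fin r → F) : Type := (Fin d → F) × (Fin r → F)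

section LM
variable {F : Type} [Field F] {d r : ℕ} (f : Sym2 (Fin d) → Fin r → F)

instance : AddCommGroup (LM F d r f) := inferInstanceAs (AddCommGroup ((Fin d → F) × (Fin r → F)))
instance : Module F (LM F d r f) := inferInstanceAs (Module F ((Fin d → F) × (Fin r → F)))
instance : Module.Finite F (LM F d r f) :=
  inferInstanceAs (Module.Finite F ((Fin d → F) × (Fin r → F)))

def LTm (u v : Fin d → F) : Fin r → F := ∑ i, ∑ j, (u i * v j) • f s(i, j)

theorem LTm_comm (u v : Fin d → F) : LTm f u v = LTm f v u := by
  unfold LTm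
  rw [Finset.sum_comm]
  refine Finset.sum_congr rfl fun i _ => Finset.sum_congr rfl fun j _ => ?_
  rw [mul_comm, Sym2.eq_swap]

theorem LTm_add (u v w : Fin d → F) : LTm f (u + v) w = LTm f u w + LTm f v w := by
  simp [LTm, add_mul, add_smul, Finset.sum_add_distrib]

theorem LTm_smul (a : F) (u w : Fin d → F) : LTm f (a • u) w = a • LTm f u w := by
  simp [LTm, mul_assoc, mul_smul, Finset.smul_sum]

theorem LTm_zero (w : Fin d → F) : LTm f 0 w = 0 := by
  simp [LTm]

theorem LTm_zero' (w : Fin d → F) : LTm f w 0 = 0 := by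
  simp [LTm]

theorem LTm_single (i j : Fin d) : LTm f (Pi.single i 1) (Pi.single j 1) = f s(i, j) := by
  unfold LTm
  rw [Finset.sum_eq_single i, Finset.sum_eq_single j]
  · simp
  · intro b _ hb; simp [hb]
  · simp
  · intro b _ hb; simp [hb]
  · simp

instance : Mul (LM F d r f) := ⟨fun x y => ((0, LTm f x.1 y.1) : (Fin d → F) × (Fin r → F))⟩

theorem LM_mul (x y : LM F d r f) : x * y = ((0, LTm f x.1 y.1) : (Fin d → F) × (Fin r → F)) := rfl

instance : NonUnitalCommRing (LM F d r f) :=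
  { (inferInstance : AddCommGroup (LM F d r f)), (inferInstance : Mul (LM F d r f)) with
    left_distrib := by
      intro a b c
      refine Prod.ext (add_zero (0 : Fin d → F)).symm ?_
      change LTm f a.1 (b.1 + c.1) = LTm f a.1 b.1 + LTm f a.1 c.1
      rw [LTm_comm, LTm_add, LTm_comm f b.1, LTm_comm f c.1]
    right_distrib := by
      intro a b c
      refine Prod.ext (add_zero (0 : Fin d → F)).symm ?_
      exact LTm_add f _ _ _
    zero_mul := by
      intro a
      exact Prod.ext rfl (LTm_zero f _)
    mul_zero := by
      intro a
      exact Prod.ext rfl (LTm_zero' f _)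
    mul_assoc := by
      intro a b c
      refine Prod.ext rfl ?_
      change LTm f 0 _ = LTm f _ 0
      rw [LTm_zero, LTm_zero']
    mul_comm := by
      intro a b
      exact Prod.ext rfl (LTm_comm f _ _) }

instance : IsScalarTower F (LM F d r f) (LM F d r f) := ⟨by
  intro a x y
  refine Prod.ext (smul_zero a).symm ?_
  exact LTm_smul f _ _ _⟩

instance : SMulCommClass F (LM F d r f) (LM F d r f) := ⟨by
  intro a x y
  simp only [smul_eq_mul]
  rw [mul_comm x (a • y), mul_comm x y, smul_mul_assoc]⟩

abbrev LA : Type := Unitization F (LM F d r f)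

def lequiv : (F × ((Fin d → F) × (Fin r → F))) ≃ₗ[F] LA f where
  toFun x := Unitization.mk ((x.1, x.2) : F × LM F d r f)
  invFun x := (x.fst, x.snd)
  map_add' _ _ := rfl
  map_smul' _ _ := rfl
  left_inv _ := rfl
  right_inv _ := rfl

def lalg {n : ℕ} (h : 1 + (d + r) = n) : FinDimAlg F n where
  carrier := LA f
  finrank_eq := by
    rw [← (lequiv f).finrank_eq]
    simpa using h

theorem lequiv_mul (i j : Fin d) : lequiv f (0, Pi.single i 1, 0) * lequiv f (0, Pi.single j 1, 0) =
    lequiv f (0, 0, f s(i, j)) := by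
  rw [← LTm_single f]
  apply Unitization.toProd_injective
  refine Prod.ext (mul_zero (0 : F)) ?_
  change (0 : F) • (_ : LM F d r f) + (0 : F) • (_ : LM F d r f) + _ = _
  rw [zero_smul, zero_smul, add_zero, zero_add]
  rfl

end LM

theorem lower_count (F : Type) [Field F] [Finite F] (n d r : ℕ) (h : 1 + (d + r) = n)
    (hfin : Finite (Quot (FinDimAlg.Iso (F := F) (n := n)))) :
    Nat.card F ^ ((d + 1).choose 2 * r) ≤ algCount F n * Nat.card F ^ (n * n) := by
  let V := F × ((Fin d → F) × (Fin r → F))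
  have hV : Module.finrank F V = n := by simp [V]; omega
  let cls : (Sym2 (Fin d) → Fin r → F) → Quot (FinDimAlg.Iso (F := F) (n := n)) :=
    fun f => Quot.mk _ (lalg f h)
  have hisoE : Equivalence (FinDimAlg.Iso (F := F) (n := n)) :=
    ⟨fun A => ⟨AlgEquiv.refl⟩, fun ⟨e⟩ => ⟨e.symm⟩, fun ⟨e⟩ ⟨e'⟩ => ⟨e.trans e'⟩⟩
  have hiso : ∀ f, Nonempty ((LA f) ≃ₐ[F] (cls f).out.carrier) := by
    intro f
    have : Quot.mk _ (lalg f h) = Quot.mk FinDimAlg.Iso (cls f).out := (Quot.out_eq (cls f)).symm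
    exact hisoE.eqvGen_iff.1 (Quot.eqvGen_exact this)
  let φ := fun f => (hiso f).some
  have hψ : ∀ A : FinDimAlg F n, Nonempty (A.carrier ≃ₗ[F] V) := by
    intro A
    have : Module.Finite F A.carrier :=
      Module.finite_of_finrank_pos (by rw [A.finrank_eq]; omega)
    exact ⟨LinearEquiv.ofFinrankEq _ _ (by rw [A.finrank_eq, hV])⟩
  let ψ := fun A => (hψ A).some
  let Φ : (Sym2 (Fin d) → Fin r → F) → Quot (FinDimAlg.Iso (F := F) (n := n)) × (V →ₗ[F] V) :=
    fun f => (cls f, (ψ (cls f).out).toLinearMap ∘ₗ (φ f).toLinearMap ∘ₗ (lequiv f).toLinearMap)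
  have hΦ : Function.Injective Φ := by
    intro f f' hff
    have h1 : cls f = cls f' := congrArg Prod.fst hff
    have h2 := congrArg Prod.snd hff
    have key : ∀ (A : FinDimAlg F n) (a : LA f ≃ₐ[F] A.carrier) (a' : LA f' ≃ₐ[F] A.carrier),
        (ψ A).toLinearMap ∘ₗ a.toLinearMap ∘ₗ (lequiv f).toLinearMap =
        (ψ A).toLinearMap ∘ₗ a'.toLinearMap ∘ₗ (lequiv f').toLinearMap → f = f' := by
      intro A a a' haa
      have e : ∀ v, a (lequiv f v) = a' (lequiv f' v) := by
        intro v
        apply (ψ A).injective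
        exact LinearMap.congr_fun haa v
      funext z
      induction z using Sym2.ind with
      | _ i j =>
        have e1 := congrArg a (lequiv_mul f i j)
        rw [map_mul, e, e, e, ← map_mul, lequiv_mul f' i j] at e1
        have e2 := (lequiv f').injective (a'.injective e1)
        exact (congrArg (fun x => x.2.2) e2).symm
    have gen : ∀ (c c' : Quot (FinDimAlg.Iso (F := F) (n := n))) (hc : c = c')
        (a : LA f ≃ₐ[F] c.out.carrier) (a' : LA f' ≃ₐ[F] c'.out.carrier),
        (ψ c.out).toLinearMap ∘ₗ a.toLinearMap ∘ₗ (lequiv f).toLinearMap =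
        (ψ c'.out).toLinearMap ∘ₗ a'.toLinearMap ∘ₗ (lequiv f').toLinearMap → f = f' := by
      intro c c' hc a a' haa
      subst hc
      exact key _ a a' haa
    exact gen _ _ h1 _ _ h2
  have hf2 := finite_lin F V V
  have := Nat.card_le_card_of_injective Φ hΦ
  rw [Nat.card_prod, card_lin, hV] at this
  have hc : Nat.card (Sym2 (Fin d) → Fin r → F) = Nat.card F ^ ((d + 1).choose 2 * r) := by
    rw [Nat.card_fun, Nat.card_fun, Nat.card_eq_fintype_card (α := Sym2 (Fin _)), Sym2.card,
      Nat.card_fin, Fintype.card_fin, ← pow_mul, mul_comm]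
  rw [hc] at this
  exact this

theorem choose_two_real (m : ℕ) : (((m + 1).choose 2 : ℕ) : ℝ) = m * (m + 1) / 2 := by
  rw [Nat.cast_choose_two]; push_cast; ring

theorem exp_bound (n s w : ℕ) (hw : w ≤ n) :
    ((n + (2 * s + 1) * (n * n) + s * (n * n) + (n - w) * n + (n - w) * (n * s) +
      (n - w) * (s * (n - w)) + (n - w + 1).choose 2 * w : ℕ) : ℝ) ≤
    2 / 27 * (n : ℝ) ^ 3 + (n + 3 * (n : ℝ) ^ 2 + 5 * (s * (n : ℝ) ^ 2)) := by
  obtain ⟨m, rfl⟩ := Nat.exists_eq_add_of_le hw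
  rw [Nat.add_sub_cancel_left]
  push_cast
  rw [choose_two_real]
  have hm : (0 : ℝ) ≤ m := Nat.cast_nonneg m
  have hw : (0 : ℝ) ≤ w := Nat.cast_nonneg w
  have hs : (0 : ℝ) ≤ s := Nat.cast_nonneg s
  have h1 : (m : ℝ) ^ 2 * w / 2 ≤ 2 / 27 * ((w : ℝ) + m) ^ 3 := by
    nlinarith [mul_nonneg (sq_nonneg ((m : ℝ) - 2 * w)) (by positivity : (0 : ℝ) ≤ 4 * m + w)]
  have h2 : 0 ≤ (s : ℝ) * w * (m : ℝ) := by positivity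
  have h3 : 0 ≤ (s : ℝ) * w * (w : ℝ) := by positivity
  have h4 : 0 ≤ (w : ℝ) * (m : ℝ) := by positivity
  nlinarith [sq_nonneg (w : ℝ), sq_nonneg (m : ℝ)]

theorem low_bound (n : ℕ) (hn : 1 ≤ n) :
    2 / 27 * (n : ℝ) ^ 3 - (n : ℝ) ^ 2 ≤ (((n - 1 - n / 3 + 1).choose 2 * (n / 3) : ℕ) : ℝ) := by
  have h0 : (0 : ℝ) ≤ (((n - 1 - n / 3 + 1).choose 2 * (n / 3) : ℕ) : ℝ) := Nat.cast_nonneg _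
  rcases Nat.lt_or_ge n 2 with h | h
  · have : n = 1 := by omega
    subst this
    refine le_trans ?_ h0
    norm_num
  · obtain ⟨r, hr⟩ : ∃ r, r = n / 3 := ⟨_, rfl⟩
    obtain ⟨d, hd⟩ : ∃ d, d = n - 1 - n / 3 := ⟨_, rfl⟩
    rw [← hd, ← hr]
    push_cast
    rw [choose_two_real]
    have e1 : n ≤ 3 * r + 2 := by omega
    have e2 : 2 * n ≤ 3 * d + 3 := by omega
    have e1' : (n : ℝ) ≤ 3 * r + 2 := by exact_mod_cast e1
    have e2' : 2 * (n : ℝ) ≤ 3 * d + 3 := by exact_mod_cast e2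
    have hn2 : (2 : ℝ) ≤ n := by exact_mod_cast h
    have hr0 : (0 : ℝ) ≤ r := Nat.cast_nonneg _
    have hd0 : (0 : ℝ) ≤ d := Nat.cast_nonneg _
    have f1 : (2 * (n : ℝ) / 3 - 1) ^ 2 ≤ (d : ℝ) ^ 2 := by
      apply pow_le_pow_left₀ <;> linarith
    have f2 : (2 * (n : ℝ) / 3 - 1) ^ 2 * ((n - 2) / 3) ≤ (d : ℝ) ^ 2 * r := by
      apply mul_le_mul f1 <;> first | positivity | linarith
    have f3 : (0 : ℝ) ≤ d * r := by positivity
    nlinarith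

/-- There is a constant `C > 0` such that for every prime power `q` (realized as the
cardinality of a finite field `F`) and every `n ≥ 1`, the number `N(q,n)` of
isomorphism classes of `n`-dimensional commutative `F_q`-algebras satisfies
`q^((2/27)n³ - C n^(8/3)) ≤ N(q,n) ≤ q^((2/27)n³ + C n^(8/3))`. -/
theorem stmt0 :
    ∃ C : ℝ, 0 < C ∧
      ∀ (F : Type) [Field F] [Fintype F] (n : ℕ), 1 ≤ n →
        (Fintype.card F : ℝ) ^ ((2 / 27 : ℝ) * (n : ℝ) ^ 3 - C * (n : ℝ) ^ ((8 : ℝ) / 3))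
            ≤ (algCount F n : ℝ) ∧
        (algCount F n : ℝ)
            ≤ (Fintype.card F : ℝ) ^ ((2 / 27 : ℝ) * (n : ℝ) ^ 3 + C * (n : ℝ) ^ ((8 : ℝ) / 3)) := by
  refine ⟨20, by norm_num, ?_⟩
  intro F _ _ n hn
  have hq1 : 1 < Fintype.card F := Fintype.one_lt_card
  have hq : (1 : ℝ) ≤ Fintype.card F := by exact_mod_cast hq1.le
  have hq0 : (0 : ℝ) < Fintype.card F := by linarith
  have hn1 : (1 : ℝ) ≤ n := by exact_mod_cast hn
  have hn0 : (0 : ℝ) < n := by linarith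
  set X : ℝ := (n : ℝ) ^ ((8 : ℝ) / 3) with hX
  have hX2 : (n : ℝ) ^ 2 ≤ X := by
    rw [← Real.rpow_natCast]
    exact Real.rpow_le_rpow_of_exponent_le hn1 (by norm_num)
  have hX1 : (n : ℝ) ≤ X := by nlinarith
  have hXs : √(n : ℝ) * (n : ℝ) ^ 2 ≤ X := by
    rw [← Real.rpow_natCast, Real.sqrt_eq_rpow, ← Real.rpow_add hn0]
    exact Real.rpow_le_rpow_of_exponent_le hn1 (by norm_num)
  obtain ⟨s, hs⟩ : ∃ s, s = Nat.sqrt n + 1 := ⟨_, rfl⟩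
  have hss : n ≤ s * s := by rw [hs]; exact (Nat.lt_succ_sqrt n).le
  have hsX : (s : ℝ) * (n : ℝ) ^ 2 ≤ 2 * X := by
    have h1 : (s : ℝ) ≤ 2 * √(n : ℝ) := by
      have a1 : (Nat.sqrt n : ℝ) ≤ √(n : ℝ) := Real.nat_sqrt_le_real_sqrt
      have a2 : (1 : ℝ) ≤ √(n : ℝ) := Real.one_le_sqrt.2 hn1
      rw [hs]; push_cast; linarith
    nlinarith [sq_nonneg (n : ℝ)]
  obtain ⟨hfin, hup⟩ := algCount_code F n s hn hss
  have hqc : Nat.card F = Fintype.card F := Nat.card_eq_fintype_card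
  constructor
  · have h := lower_count F n (n - 1 - n / 3) (n / 3) (by omega) hfin
    rw [hqc] at h
    have h' : (Fintype.card F : ℝ) ^ ((n - 1 - n / 3 + 1).choose 2 * (n / 3)) ≤
        algCount F n * (Fintype.card F : ℝ) ^ (n * n) := by exact_mod_cast h
    have hb := low_bound n hn
    have hpos : (0 : ℝ) < (Fintype.card F : ℝ) ^ (n * n) := by positivity
    refine le_of_mul_le_mul_right (le_trans ?_ h') hpos
    rw [← Real.rpow_natCast (Fintype.card F : ℝ) (n * n), ← Real.rpow_natCast (Fintype.card F : ℝ)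
      ((n - 1 - n / 3 + 1).choose 2 * (n / 3)), ← Real.rpow_add hq0]
    apply Real.rpow_le_rpow_of_exponent_le hq
    refine le_trans ?_ hb
    push_cast
    nlinarith
  · have hcard : ∀ w : Fin (n + 1), (Nat.card (CCode F n s w) : ℝ) ≤
        (Fintype.card F : ℝ) ^ ((2 / 27 : ℝ) * (n : ℝ) ^ 3 + 14 * X) := by
      intro w
      rw [card_code F n s w (by omega), hqc]
      rw [Nat.cast_pow, ← Real.rpow_natCast]
      apply Real.rpow_le_rpow_of_exponent_le hq
      refine (exp_bound n s w (by omega)).trans ?_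
      linarith
    have h1 : (algCount F n : ℝ) ≤
        (n + 1) * (Fintype.card F : ℝ) ^ ((2 / 27 : ℝ) * (n : ℝ) ^ 3 + 14 * X) := by
      refine le_trans (Nat.cast_le.2 hup) ?_
      rw [Nat.cast_sum]
      refine (Finset.sum_le_sum fun w _ => hcard w).trans ?_
      simp
    have h2 : (n : ℝ) + 1 ≤ (Fintype.card F : ℝ) ^ X := by
      have a1 : n + 1 ≤ Fintype.card F ^ n := Nat.lt_pow_self hq1
      have a2 : (n : ℝ) + 1 ≤ (Fintype.card F : ℝ) ^ n := by exact_mod_cast a1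
      refine a2.trans ?_
      rw [← Real.rpow_natCast]
      exact Real.rpow_le_rpow_of_exponent_le hq hX1
    refine h1.trans ((mul_le_mul_of_nonneg_right h2 (by positivity)).trans ?_)
    rw [← Real.rpow_add hq0]
    apply Real.rpow_le_rpow_of_exponent_le hq
    linarith
end

section
/- There exists a constant C > 0 such that for every prime p and every integer n ≥ 1, the number R(p^n) of isomorphism classes of finite commutative rings of cardinality p^n satisfies p^{(2/27)n^3 - C n^{8/3}} ≤ R(p^n) ≤ p^{(2/27)n^3 + C n^{8/3}}. -/
/-- A finite commutative (unital) ring of cardinality `m`, bundled with its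
carrier type. -/
structure FinCommRingOfCard (m : ℕ) : Type 1 where
  carrier : Type
  [commRing : CommRing carrier]
  card_eq : Nat.card carrier = m

attribute [instance] FinCommRingOfCard.commRing

/-- Two bundled rings are isomorphic when there is a ring isomorphism between them. -/
def FinCommRingOfCard.Iso {m : ℕ} (A B : FinCommRingOfCard m) : Prop :=
  Nonempty (A.carrier ≃+* B.carrier)

/-- The number of isomorphism classes of commutative rings of cardinality `m`. -/
noncomputable def ringCount (m : ℕ) : ℕ :=
  Nat.card (Quot (FinCommRingOfCard.Iso (m := m)))

namespace RC
set_option linter.unusedSectionVars false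

open ArithmeticFunction

noncomputable def el {X : Type*} [AddCommGroup X] (H : AddSubgroup X) : ℕ :=
  ArithmeticFunction.cardFactors (Nat.card H)

section el
variable {X Y : Type*} [AddCommGroup X] [AddCommGroup Y] [Finite X] [Finite Y]

lemma card_relIndex {H K : AddSubgroup X} (h : H ≤ K) :
    Nat.card H * H.relIndex K = Nat.card K := by
  have := AddSubgroup.relIndex_mul_relIndex (⊥ : AddSubgroup X) H K bot_le h
  simpa [AddSubgroup.relIndex_bot_left] using this

lemma el_relIndex {H K : AddSubgroup X} (h : H ≤ K) :
    el K = el H + ArithmeticFunction.cardFactors (H.relIndex K) := by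
  have h1 := card_relIndex h
  have h2 : Nat.card K ≠ 0 := Nat.card_pos.ne'
  unfold el
  rw [← h1, cardFactors_mul]
  · exact Nat.card_pos.ne'
  · intro h0; rw [h0] at h1; simp at h1; exact h2 h1.symm

lemma el_mono {H K : AddSubgroup X} (h : H ≤ K) : el H ≤ el K := by
  rw [el_relIndex h]; omega

lemma el_lt {H K : AddSubgroup X} (h : H < K) : el H < el K := by
  rw [el_relIndex h.le]
  have h1 := card_relIndex h.le
  have h2 : Nat.card K ≠ 0 := Nat.card_pos.ne'
  have : 0 < ArithmeticFunction.cardFactors (H.relIndex K) := by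
    rw [cardFactors_pos_iff_one_lt]
    have h3 : H.relIndex K ≠ 0 := by
      intro h0; rw [h0] at h1; simp at h1; exact h2 h1.symm
    have h4 : H.relIndex K ≠ 1 := by
      rw [Ne, AddSubgroup.relIndex_eq_one]
      exact fun h' => absurd h (not_lt_of_ge h')
    omega
  omega

lemma el_mod (A B : AddSubgroup X) : el (A ⊔ B) + el (A ⊓ B) = el A + el B := by
  have h1 := el_relIndex (le_sup_right : B ≤ A ⊔ B)
  have h2 := el_relIndex (inf_le_left : A ⊓ B ≤ A)
  rw [AddSubgroup.relIndex_sup_right] at h1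
  rw [AddSubgroup.inf_relIndex_left] at h2
  omega

lemma el_ker (K : AddSubgroup X) (f : X →+ Y) : el K = el (K ⊓ f.ker) + el (K.map f) := by
  have h2 := el_relIndex (inf_le_left : K ⊓ f.ker ≤ K)
  rw [AddSubgroup.inf_relIndex_left, AddSubgroup.relIndex_ker] at h2
  exact h2

lemma el_comap (K : AddSubgroup X) (f : X →+ Y) (U : AddSubgroup Y) :
    el K + el U = el (K ⊓ U.comap f) + el (K.map f ⊔ U) := by
  have h1 := el_ker K f
  have h2 := el_ker (K ⊓ U.comap f) f
  have h3 := el_mod (K.map f) U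
  have h4 : (K ⊓ U.comap f).map f = K.map f ⊓ U := by
    ext x
    constructor
    · rintro ⟨y, ⟨hy1, hy2⟩, rfl⟩
      exact ⟨⟨y, hy1, rfl⟩, hy2⟩
    · rintro ⟨⟨y, hy, rfl⟩, h⟩
      exact ⟨y, ⟨hy, h⟩, rfl⟩
  have h5 : K ⊓ U.comap f ⊓ f.ker = K ⊓ f.ker := by
    ext x
    constructor
    · rintro ⟨⟨h1, h2⟩, h3⟩; exact ⟨h1, h3⟩
    · rintro ⟨h1, h3⟩
      refine ⟨⟨h1, ?_⟩, h3⟩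
      have : f x = 0 := h3
      change f x ∈ U
      rw [this]; exact U.zero_mem
  rw [h4, h5] at h2
  omega

lemma exists_gens : ∀ (m : ℕ) (K' K : AddSubgroup X), K' ≤ K → el K ≤ el K' + m →
    ∃ Z : Finset X, (Z : Set X) ⊆ K ∧ Z.card ≤ m ∧ K ≤ K' ⊔ AddSubgroup.closure (Z : Set X) := by
  classical
  intro m
  induction m with
  | zero =>
    intro K' K h h0
    refine ⟨∅, by simp, by simp, ?_⟩
    have : K' = K := by
      by_contra hne
      have := el_lt (lt_of_le_of_ne h hne)
      omega
    rw [this]; exact le_sup_left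
  | succ m ih =>
    intro K' K h h0
    by_cases hne : K' = K
    · exact ⟨∅, by simp, by simp, by rw [hne]; exact le_sup_left⟩
    · obtain ⟨z, hz, hz'⟩ := SetLike.exists_of_lt (lt_of_le_of_ne h hne)
      have h1 : K' < K' ⊔ AddSubgroup.closure {z} := by
        refine lt_of_le_of_ne le_sup_left ?_
        intro he
        apply hz'
        rw [he]
        exact (le_sup_right : AddSubgroup.closure {z} ≤ _)
          (AddSubgroup.subset_closure (Set.mem_singleton z))
      have h2 := el_lt h1
      obtain ⟨Z, hZ1, hZ2, hZ3⟩ := ih (K' ⊔ AddSubgroup.closure {z}) K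
        (sup_le h (by rw [AddSubgroup.closure_le]; simpa using hz)) (by omega)
      refine ⟨insert z Z, ?_, ?_, ?_⟩
      · rw [Finset.coe_insert]; exact Set.insert_subset hz hZ1
      · exact (Finset.card_insert_le _ _).trans (by omega)
      · refine hZ3.trans ?_
        rw [sup_assoc, ← AddSubgroup.closure_union, Finset.coe_insert, Set.insert_eq]

end el

section sims
variable {R : Type*} [CommRing R] [Finite R]

/-- multiplication by `z` -/
abbrev ml (z : R) : R →+ R := AddMonoidHom.mulLeft z

/-- sum of `s K`, `s ∈ S` -/
def sp (S : Finset R) (K : AddSubgroup R) : AddSubgroup R := ⨆ s ∈ S, K.map (ml s)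

omit [Finite R] in
lemma le_sp {S : Finset R} {K : AddSubgroup R} {s : R} (h : s ∈ S) : K.map (ml s) ≤ sp S K :=
  le_iSup₂_of_le s h le_rfl

omit [Finite R] in
lemma sp_mono {S T : Finset R} {K L : AddSubgroup R} (h : S ⊆ T) (h' : K ≤ L) : sp S K ≤ sp T L :=
  iSup₂_le fun s hs => (AddSubgroup.map_mono h').trans (le_sp (h hs))

lemma halving (J : AddSubgroup R) : ∀ (t : ℕ) (K U : AddSubgroup R),
    (∀ z ∈ J, el (K.map (ml z) ⊔ U) ≤ t + el U) →
    ∃ S : Finset R, (S : Set R) ⊆ J ∧ S.card ≤ t ∧ ∃ K' ≤ K, el K ≤ el K' + 2 * t ∧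
      ∀ a ∈ J, K'.map (ml a) ≤ U ⊔ sp S K := by
  classical
  intro t
  induction t using Nat.strong_induction_on with
  | _ t ih =>
  intro K U h
  -- choose maximal rank
  obtain ⟨y, hyJ, hy⟩ : ∃ y ∈ J, ∀ z ∈ J, el (K.map (ml z) ⊔ U) ≤ el (K.map (ml y) ⊔ U) := by
    obtain ⟨y, hy1, hy2⟩ := Set.exists_max_image (J : Set R) (fun z => el (K.map (ml z) ⊔ U))
      (Set.toFinite _) ⟨0, J.zero_mem⟩
    exact ⟨y, hy1, hy2⟩
  set U1 := K.map (ml y) ⊔ U with hU1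
  have hUU1 : U ≤ U1 := le_sup_right
  obtain ⟨r, hr⟩ : ∃ r, el U1 = r + el U := ⟨el U1 - el U, by have := el_mono hUU1; omega⟩
  have hrt : r ≤ t := by have := h y hyJ; rw [← hU1] at this; omega
  rcases Nat.eq_zero_or_pos r with h0 | hpos
  · refine ⟨∅, by simp, by simp, K, le_rfl, by omega, ?_⟩
    intro a ha
    have h1 : U = K.map (ml a) ⊔ U := by
      by_contra hne
      have := el_lt (lt_of_le_of_ne (le_sup_right : U ≤ K.map (ml a) ⊔ U) hne)
      have := hy a ha
      omega
    have h2 : K.map (ml a) ≤ U := by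
      conv_rhs => rw [h1]
      exact le_sup_left
    exact h2.trans le_sup_left
  set K1 := K ⊓ U.comap (ml y) with hK1
  have hc := el_comap K (ml y) U
  rw [← hU1, ← hK1] at hc
  have key : ∀ z ∈ J, el (K1.map (ml z) ⊔ U1) ≤ r / 2 + el U1 := by
    intro z hz
    set P := K1.map (ml z) ⊔ U with hP
    have hA := hy z hz
    have hA' := hy (y + z) (J.add_mem hyJ hz)
    set A := K.map (ml z) ⊔ U with hAdef
    set A' := K.map (ml (y + z)) ⊔ U with hAdef'
    have e1 : P ≤ A := sup_le_sup_right (AddSubgroup.map_mono inf_le_left) _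
    have e2 : P ≤ A' := by
      refine sup_le ?_ le_sup_right
      rintro _ ⟨v, ⟨hv1, hv2⟩, rfl⟩
      have h1 : (y + z) * v ∈ A' := (le_sup_left : _ ≤ A') ⟨v, hv1, rfl⟩
      have h2 : y * v ∈ A' := (le_sup_right : U ≤ A') hv2
      have h3 : z * v = (y + z) * v - y * v := by ring
      change z * v ∈ A'
      rw [h3]; exact A'.sub_mem h1 h2
    have e3 : U1 ⊔ P ≤ A ⊔ A' := by
      refine sup_le (sup_le ?_ (le_sup_right.trans le_sup_left)) (e1.trans le_sup_left)
      rintro _ ⟨v, hv, rfl⟩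
      have h1 : (y + z) * v ∈ A ⊔ A' :=
        (le_sup_right : A' ≤ A ⊔ A') ((le_sup_left : _ ≤ A') ⟨v, hv, rfl⟩)
      have h2 : z * v ∈ A ⊔ A' :=
        (le_sup_left : A ≤ A ⊔ A') ((le_sup_left : _ ≤ A) ⟨v, hv, rfl⟩)
      have h3 : y * v = (y + z) * v - z * v := by ring
      change y * v ∈ A ⊔ A'
      rw [h3]; exact (A ⊔ A').sub_mem h1 h2
    have e4 : P ≤ A ⊓ A' := le_inf e1 e2
    have e5 : U ≤ U1 ⊓ P := le_inf hUU1 le_sup_right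
    have m1 := el_mod A A'
    have m2 := el_mod U1 P
    have n3 := el_mono e3
    have n4 := el_mono e4
    have n5 := el_mono e5
    have e6 : K1.map (ml z) ⊔ U1 ≤ U1 ⊔ P :=
      sup_le (le_sup_left.trans le_sup_right) le_sup_left
    have n6 := el_mono e6
    omega
  obtain ⟨S, hS1, hS2, K', hK', hK'2, hfin⟩ := ih (r / 2) (by omega) K1 U1 key
  refine ⟨insert y S, ?_, ?_, K', hK'.trans inf_le_left, by omega, ?_⟩
  · rw [Finset.coe_insert]; exact Set.insert_subset hyJ hS1
  · exact (Finset.card_insert_le _ _).trans (by omega)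
  · intro a ha
    refine (hfin a ha).trans ?_
    refine sup_le (sup_le ?_ le_sup_left) ?_
    · exact (le_sp (Finset.mem_insert_self y S)).trans le_sup_right
    · exact (sp_mono (Finset.subset_insert _ _) inf_le_left).trans le_sup_right

/-- few multipliers generate all products -/
lemma sims (J : AddSubgroup R) (n t : ℕ) (hn : el (⊤ : AddSubgroup R) ≤ n) (ht0 : 0 < t) (ht : n ≤ t * t) :
    ∃ S : Finset R, (S : Set R) ⊆ J ∧ S.card ≤ 4 * t ∧ ∀ a ∈ J, ∀ b ∈ J, a * b ∈ sp S J := by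
  classical
  -- greedy step
  obtain ⟨Y, hYJ, hYc, hY⟩ : ∃ Y : Finset R, (Y : Set R) ⊆ J ∧ Y.card * t ≤ el (sp Y J) ∧
      ∀ z ∈ J, el (J.map (ml z) ⊔ sp Y J) ≤ t + el (sp Y J) := by
    have : ∃ Y ∈ {Y : Finset R | (Y : Set R) ⊆ J ∧ Y.card * t ≤ el (sp Y J)},
        ∀ Y' ∈ {Y : Finset R | (Y : Set R) ⊆ J ∧ Y.card * t ≤ el (sp Y J)},
          el (sp Y' J) ≤ el (sp Y J) :=
      Set.exists_max_image _ _ (Set.toFinite _) ⟨∅, by simp⟩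
    obtain ⟨Y, ⟨h1, h2⟩, h3⟩ := this
    refine ⟨Y, h1, h2, ?_⟩
    intro z hz
    by_contra hcon
    have hle : J.map (ml z) ⊔ sp Y J ≤ sp (insert z Y) J :=
      sup_le (le_sp (Finset.mem_insert_self _ _)) (sp_mono (Finset.subset_insert _ _) le_rfl)
    have hle' := el_mono hle
    have := h3 (insert z Y) ⟨by rw [Finset.coe_insert]; exact Set.insert_subset hz h1, by
      have := Finset.card_insert_le z Y
      have : (insert z Y).card * t ≤ (Y.card + 1) * t := Nat.mul_le_mul_right _ this
      have h5 : (Y.card + 1) * t = Y.card * t + t := by ring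
      omega⟩
    omega
  have hYt : Y.card ≤ t := by
    have h1 := el_mono (le_top : sp Y J ≤ ⊤)
    have h2 : Y.card * t ≤ t * t := by omega
    exact Nat.le_of_mul_le_mul_right h2 ht0
  obtain ⟨S, hS1, hS2, K', hK', hK'2, hfin⟩ := halving J t J (sp Y J) hY
  obtain ⟨Z, hZ1, hZ2, hZ3⟩ := exists_gens (2 * t) K' J hK' hK'2
  refine ⟨Y ∪ S ∪ Z, ?_, ?_, ?_⟩
  · simp only [Finset.coe_union, Set.union_subset_iff]; exact ⟨⟨hYJ, hS1⟩, hZ1⟩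
  · have := Finset.card_union_le (Y ∪ S) Z
    have := Finset.card_union_le Y S
    omega
  · intro a ha b hb
    have hb' := hZ3 hb
    have h1 : J ≤ (sp (Y ∪ S ∪ Z) J).comap (ml a) := by
      refine hZ3.trans (sup_le ?_ ?_)
      · rw [← AddSubgroup.map_le_iff_le_comap]
        refine (hfin a ha).trans (sup_le (sp_mono ?_ le_rfl) (sp_mono ?_ le_rfl))
        · intro x; simp; tauto
        · intro x; simp; tauto
      · rw [AddSubgroup.closure_le]
        intro z hz
        change a * z ∈ sp (Y ∪ S ∪ Z) J
        rw [mul_comm]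
        exact le_sp (K := J) (Finset.mem_union_right _ hz) ⟨a, ha, rfl⟩
    exact h1 hb

end sims

section ugens

lemma card_le_Omega {ι : Type*} (s : Finset ι) (f : ι → ℕ) (hf : ∀ i, 1 < f i) :
    s.card ≤ ArithmeticFunction.cardFactors (∏ i ∈ s, f i) := by
  classical
  induction s using Finset.induction_on with
  | empty => simp
  | insert a s ha ih =>
    rw [Finset.prod_insert ha, Finset.card_insert_of_notMem ha, cardFactors_mul]
    · have := cardFactors_pos_iff_one_lt.2 (hf a)
      omega
    · have := hf a; omega
    · rw [Finset.prod_ne_zero_iff]; intro i _; have := hf i; omega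

lemma Omega_dvd {a b : ℕ} (h : a ∣ b) (hb : b ≠ 0) :
    ArithmeticFunction.cardFactors a ≤ ArithmeticFunction.cardFactors b := by
  obtain ⟨c, rfl⟩ := h
  rw [cardFactors_mul]
  · omega
  · rintro rfl; simp at hb
  · rintro rfl; simp at hb

lemma ugens_aux {R : Type*} [CommRing R] {I : Type*} [Fintype I] (K : I → Type*)
    [∀ i, Field (K i)] [∀ i, Finite (K i)] (π : R →+* (∀ i, K i)) (hπ : Function.Surjective π)
    (q : ℕ) (hq : Fintype.card I ≤ q * q) :
    ∃ S : Finset R, S.card ≤ 2 * q + 1 ∧ ∀ T : AddSubgroup R, 1 ∈ T →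
      (∀ s ∈ S, ∀ x ∈ T, s * x ∈ T) → ∀ r : R, ∃ a ∈ T, π r = π a := by
  classical
  have hg : ∀ i, ∃ g : (K i)ˣ, ∀ x, x ∈ Submonoid.powers g :=
    fun i => IsCyclic.exists_monoid_generator
  choose g hg using hg
  obtain ⟨e⟩ : Nonempty (I ↪ Fin q × Fin q) :=
    Function.Embedding.nonempty_of_card_le (by simpa using hq)
  choose σ hσ using hπ
  let h : R := σ (fun i => (g i : K i))
  let F : Fin q → R := fun a => σ (fun i => if (e i).1 = a then 1 else 0)
  let G : Fin q → R := fun a => σ (fun i => if (e i).2 = a then 1 else 0)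
  refine ⟨insert h (Finset.univ.image F ∪ Finset.univ.image G), ?_, ?_⟩
  · have h1 := Finset.card_insert_le h (Finset.univ.image F ∪ Finset.univ.image G)
    have h2 := Finset.card_union_le (Finset.univ.image F) (Finset.univ.image G)
    have h3 : (Finset.univ.image F).card ≤ q := by
      simpa using (Finset.card_image_le (s := Finset.univ) (f := F))
    have h4 : (Finset.univ.image G).card ≤ q := by
      simpa using (Finset.card_image_le (s := Finset.univ) (f := G))
    omega
  · intro T h1 hT r
    have hh : ∀ x ∈ T, h * x ∈ T := hT h (by simp)
    have hF : ∀ a, ∀ x ∈ T, F a * x ∈ T := fun a => hT _ (by simp)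
    have hG : ∀ a, ∀ x ∈ T, G a * x ∈ T := fun a => hT _ (by simp)
    have hpow : ∀ k : ℕ, h ^ k ∈ T := by
      intro k
      induction k with
      | zero => simpa using h1
      | succ k ih => rw [pow_succ']; exact hh _ ih
    -- single elements
    have hs : ∀ i, ∃ a ∈ T, π a = Pi.single i (π r i) := by
      intro i
      by_cases h0 : π r i = 0
      · exact ⟨0, T.zero_mem, by simp [h0]⟩
      · obtain ⟨k, hk⟩ := hg i (Units.mk0 _ h0)
        have hk' : (g i : K i) ^ k = π r i := by
          have := congrArg Units.val hk
          simpa using this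
        refine ⟨F (e i).1 * (G (e i).2 * h ^ k), hF _ _ (hG _ _ (hpow k)), ?_⟩
        rw [map_mul, map_mul, map_pow, hσ, hσ, hσ]
        funext j
        by_cases hij : j = i
        · subst hij; simp [hk']
        · have : e j ≠ e i := fun h => hij (e.injective h)
          rw [Pi.single_eq_of_ne hij]
          simp only [Pi.mul_apply, Pi.pow_apply]
          by_cases h5 : (e j).1 = (e i).1
          · have h6 : (e j).2 ≠ (e i).2 := fun h6 => this (Prod.ext h5 h6)
            simp [h6]
          · simp [h5]
    choose a ha ha' using hs
    refine ⟨∑ i, a i, T.sum_mem fun i _ => ha i, ?_⟩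
    rw [map_sum]
    simp_rw [ha']
    exact (Finset.univ_sum_single (π r)).symm

lemma ugens {R : Type*} [CommRing R] [Finite R] (n q : ℕ)
    (hn : el (⊤ : AddSubgroup R) ≤ n) (hq : n ≤ q * q) :
    ∃ S : Finset R, S.card ≤ 2 * q + 1 ∧ ∀ T : AddSubgroup R, 1 ∈ T →
      (∀ s ∈ S, ∀ x ∈ T, s * x ∈ T) → ∀ r : R, ∃ a ∈ T, r - a ∈ nilradical R := by
  classical
  let E := R ⧸ nilradical R
  have : IsReduced E := by
    rw [← Ideal.isRadical_iff_quotient_reduced]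
    exact Ideal.radical_isRadical _
  have : Finite E := Finite.of_surjective _ (Ideal.Quotient.mk_surjective (I := nilradical R))
  have : Fintype (MaximalSpectrum E) := Fintype.ofFinite _
  let φ := IsArtinianRing.equivPi E
  letI : ∀ i : MaximalSpectrum E, Field (E ⧸ i.asIdeal) := fun i => Ideal.Quotient.field _
  let π : R →+* (∀ i : MaximalSpectrum E, E ⧸ i.asIdeal) :=
    (φ : E →+* _).comp (Ideal.Quotient.mk (nilradical R))
  have hπ : Function.Surjective π := φ.surjective.comp Ideal.Quotient.mk_surjective
  have hfin : ∀ i : MaximalSpectrum E, Finite (E ⧸ i.asIdeal) := 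
    fun i => Finite.of_surjective _ (Ideal.Quotient.mk_surjective (I := i.asIdeal))
  have hcard : Fintype.card (MaximalSpectrum E) ≤ n := by
    have h1 := card_le_Omega (Finset.univ : Finset (MaximalSpectrum E))
      (fun i => Nat.card (E ⧸ i.asIdeal)) (fun i => Finite.one_lt_card)
    rw [← Nat.card_pi] at h1
    refine h1.trans (le_trans (Omega_dvd ?_ Nat.card_pos.ne') hn)
    have h2 : Nat.card (∀ i : MaximalSpectrum E, E ⧸ i.asIdeal) ∣ Nat.card R :=
      AddSubgroup.card_dvd_of_surjective π.toAddMonoidHom hπ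
    simpa using h2
  obtain ⟨S, hS, h⟩ := ugens_aux _ π hπ q (hcard.trans hq)
  refine ⟨S, hS, fun T h1 h2 r => ?_⟩
  obtain ⟨a, ha, hra⟩ := h T h1 h2 r
  refine ⟨a, ha, ?_⟩
  have := φ.injective hra
  exact (Ideal.Quotient.eq).1 this

end ugens

section data

/-- `T = R` as soon as `T` contains `1`, `X` and is stable under multiplication by `S` -/
def Spans {R : Type*} [CommRing R] (S X : Set R) : Prop :=
  ∀ T : AddSubgroup R, 1 ∈ T → X ⊆ T → (∀ s ∈ S, ∀ x ∈ T, s * x ∈ T) → T = ⊤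

lemma exists_data {R : Type*} [CommRing R] [Finite R] (n t : ℕ)
    (hn : el (⊤ : AddSubgroup R) ≤ n) (ht0 : 0 < t) (ht : n ≤ t * t) :
    ∃ d ≤ n, ∃ H : AddSubgroup R, el H + d ≤ n ∧ ∃ S : Finset R, S.card ≤ 6 * t + 1 ∧
      ∃ X : Finset R, X.card ≤ d ∧ (∀ x ∈ X, ∀ y ∈ X, x * y ∈ H) ∧
        Spans (S : Set R) (X : Set R) := by
  classical
  set N := nilradical R with hN
  let J : AddSubgroup R := N.toAddSubgroup
  let H : AddSubgroup R := (N * N).toAddSubgroup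
  have hHJ : H ≤ J := fun x hx => Ideal.mul_le_right (I := N) (J := N) hx
  obtain ⟨S1, hS1c, hS1⟩ := ugens (R := R) n t hn ht
  obtain ⟨S2, hS2J, hS2c, hS2⟩ := sims J n t hn ht0 ht
  obtain ⟨X, hXJ, hXc, hX⟩ := exists_gens (el J - el H) H J hHJ (by omega)
  have h1 := el_mono hHJ
  have h2 := el_mono (le_top : J ≤ ⊤)
  refine ⟨el J - el H, by omega, H, by omega, S1 ∪ S2, ?_, X, hXc, ?_, ?_⟩
  · have := Finset.card_union_le S1 S2; omega
  · intro x hx y hy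
    exact Ideal.mul_mem_mul (hXJ hx) (hXJ hy)
  · intro T hT1 hTX hTS
    have hHsp : H ≤ sp S2 J := by
      intro x hx
      refine Submodule.mul_induction_on (M := N) (N := N) (C := fun x => x ∈ sp S2 J) hx ?_ ?_
      · intro a ha b hb; exact hS2 a ha b hb
      · intro a b ha hb; exact (sp S2 J).add_mem ha hb
    have key : ∀ k : ℕ, J ≤ T ⊔ (N ^ k).toAddSubgroup := by
      intro k
      induction k with
      | zero =>
        intro x _
        refine (le_sup_right : (N ^ 0).toAddSubgroup ≤ _) ?_
        change x ∈ N ^ 0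
        simp
      | succ k ih =>
        have hsp : sp S2 J ≤ T ⊔ (N ^ (k + 1)).toAddSubgroup := by
          refine iSup₂_le fun s hs => ?_
          rintro _ ⟨v, hv, rfl⟩
          obtain ⟨a, ha, b, hb, rfl⟩ := AddSubgroup.mem_sup.1 (ih hv)
          change s * (a + b) ∈ _
          rw [mul_add]
          refine AddSubgroup.add_mem_sup (hTS s (by simp [hs]) a ha) ?_
          change s * b ∈ N ^ (k + 1)
          rw [pow_succ']
          exact Ideal.mul_mem_mul (hS2J hs) hb
        refine hX.trans (sup_le (hHsp.trans hsp) ?_)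
        exact ((AddSubgroup.closure_le _).2 hTX).trans le_sup_left
    have hJT : J ≤ T := by
      obtain ⟨k, hk⟩ := IsArtinianRing.isNilpotent_nilradical (R := R)
      have := key k
      rw [hk] at this
      refine this.trans (sup_le le_rfl ?_)
      intro x hx
      have hx' : x = 0 := by simpa using hx
      rw [hx']; exact T.zero_mem
    rw [eq_top_iff]
    intro r _
    obtain ⟨a, ha, hra⟩ := hS1 T hT1 (fun s hs => hTS s (by simp [hs])) r
    have : r = (r - a) + a := by ring
    rw [this]
    exact T.add_mem (hJT hra) ha

lemma pad {R : Type*} [Zero R] (S : Finset R) (s : ℕ) (h : S.card ≤ s) :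
    ∃ f : Fin s → R, (S : Set R) ⊆ Set.range f ∧ Set.range f ⊆ insert 0 (S : Set R) := by
  classical
  refine ⟨fun i => if h : (i : ℕ) < S.card then (S.equivFin.symm ⟨i, h⟩ : R) else 0, ?_, ?_⟩
  · intro x hx
    let j := S.equivFin ⟨x, hx⟩
    refine ⟨⟨j, j.2.trans_le h⟩, ?_⟩
    simp [j]
  · rintro _ ⟨i, rfl⟩
    by_cases h : (i : ℕ) < S.card
    · simp [h]
    · simp [h]

/-- the multiplication is determined by the data -/
lemma determined {A B : Type*} [CommRing A] [CommRing B] (ψ : A ≃+ B) {s d : ℕ}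
    (w : Fin s → A) (w' : Fin s → B) (x : Fin d → A) (x' : Fin d → B)
    (hA : Spans (Set.range w) (Set.range x)) (h1 : ψ 1 = 1)
    (hw : ∀ i a, ψ (w i * a) = w' i * ψ a) (hx : ∀ i, ψ (x i) = x' i)
    (hxx : ∀ i j, ψ (x i * x j) = x' i * x' j) : ∀ a b, ψ (a * b) = ψ a * ψ b := by
  let T : AddSubgroup A :=
    { carrier := {a | ∀ b, ψ (a * b) = ψ a * ψ b}
      zero_mem' := by intro b; simp
      add_mem' := by intro a a' ha ha' b; rw [add_mul, map_add, map_add, add_mul, ha, ha']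
      neg_mem' := by intro a ha b; rw [neg_mul, map_neg, map_neg, neg_mul, ha] }
  have hTx : ∀ j, x j ∈ T := by
    intro j
    let Tj : AddSubgroup A :=
      { carrier := {b | ψ (x j * b) = x' j * ψ b}
        zero_mem' := by simp
        add_mem' := by
          intro a a' ha ha'
          simp only [Set.mem_setOf_eq] at *
          rw [mul_add, map_add, map_add, mul_add, ha, ha']
        neg_mem' := by
          intro a ha
          simp only [Set.mem_setOf_eq] at *
          rw [mul_neg, map_neg, map_neg, mul_neg, ha] }
    have : Tj = ⊤ := by
      refine hA Tj ?_ ?_ ?_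
      · change ψ (x j * 1) = x' j * ψ 1
        rw [mul_one, h1, mul_one, hx]
      · rintro _ ⟨k, rfl⟩
        change ψ (x j * x k) = x' j * ψ (x k)
        rw [hxx, hx]
      · rintro _ ⟨i, rfl⟩ a ha
        have ha' : ψ (x j * a) = x' j * ψ a := ha
        change ψ (x j * (w i * a)) = x' j * ψ (w i * a)
        rw [mul_left_comm, hw, ha', hw, mul_left_comm]
    intro b
    have hb : b ∈ Tj := by rw [this]; trivial
    have hb' : ψ (x j * b) = x' j * ψ b := hb
    rw [hb', hx]
  have hT : T = ⊤ := by
    refine hA T ?_ ?_ ?_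
    · intro b; rw [one_mul, h1, one_mul]
    · rintro _ ⟨j, rfl⟩; exact hTx j
    · rintro _ ⟨i, rfl⟩ a ha b
      have ha' : ∀ b, ψ (a * b) = ψ a * ψ b := ha
      rw [mul_assoc, hw, ha', hw, mul_assoc]
  intro a b
  have ha : a ∈ T := by rw [hT]; trivial
  exact ha b

end data

section codes

open Classical in
/-- a decoder onto `α`, surjective when possible -/
noncomputable def dec (α : Type) [Nonempty α] (N : ℕ) : Fin N → α :=
  if h : ∃ f : Fin N → α, Function.Surjective f then h.choose else fun _ => Classical.arbitrary α

lemma dec_surj (α : Type) [Nonempty α] [Finite α] (N : ℕ) (h : Nat.card α ≤ N) :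
    Function.Surjective (dec α N) := by
  have hex : ∃ f : Fin N → α, Function.Surjective f := by
    let e := Finite.equivFin α
    have hpos : 0 < Nat.card α := Nat.card_pos
    refine ⟨fun i => e.symm ⟨min i (Nat.card α - 1), by omega⟩, ?_⟩
    intro a
    refine ⟨⟨e a, (e a).2.trans_le h⟩, ?_⟩
    rw [Equiv.symm_apply_eq]
    ext
    have := (e a).2
    simp; omega
  rw [dec, dif_pos hex]
  exact hex.choose_spec

lemma card_le_of_code {α β : Type*} [Finite β] (P : α → β → Prop) (h1 : ∀ a, ∃ b, P a b)
    (h2 : ∀ a a' b, P a b → P a' b → a = a') : Finite α ∧ Nat.card α ≤ Nat.card β := by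
  choose f hf using h1
  have hinj : Function.Injective f := by
    intro a a' h
    exact h2 a a' (f a) (hf a) (h ▸ hf a')
  exact ⟨Finite.of_injective f hinj, Nat.card_le_card_of_injective f hinj⟩

lemma el_top_of_card {X : Type*} [AddCommGroup X] {p n : ℕ} (hp : p.Prime)
    (h : Nat.card X = p ^ n) : el (⊤ : AddSubgroup X) = n := by
  rw [el, AddSubgroup.card_top, h, cardFactors_apply_prime_pow hp]

lemma exists_fin_gens {X : Type*} [AddCommGroup X] [Finite X] (H : AddSubgroup X) (n : ℕ)
    (h : el H ≤ n) : ∃ g : Fin n → X, AddSubgroup.closure (Set.range g) = H := by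
  obtain ⟨Z, hZ1, hZ2, hZ3⟩ := exists_gens n ⊥ H bot_le (by omega)
  obtain ⟨g, hg1, hg2⟩ := pad Z n hZ2
  refine ⟨g, le_antisymm ?_ ?_⟩
  · rw [AddSubgroup.closure_le]
    exact hg2.trans (Set.insert_subset H.zero_mem hZ1)
  · rw [bot_sup_eq] at hZ3
    exact hZ3.trans (AddSubgroup.closure_mono hg1)

lemma card_eq_pow_el {X : Type*} [AddCommGroup X] [Finite X] {p n : ℕ} (hp : p.Prime)
    (h : Nat.card X = p ^ n) (H : AddSubgroup X) : Nat.card H = p ^ (el H) := by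
  have h1 : Nat.card H ∣ p ^ n := h ▸ H.card_addSubgroup_dvd_card
  obtain ⟨k, -, hk⟩ := (Nat.dvd_prime_pow hp).1 h1
  rw [el, hk, cardFactors_apply_prime_pow hp]

abbrev Code (D : Type) (p n s : ℕ) : Type :=
  D × (Fin s → Fin n → Fin (p ^ n)) × Fin (p ^ n) × (Fin n → Fin (p ^ n)) ×
    (Σ d : Fin (n + 1), (Fin d → Fin (p ^ n)) × (Sym2 (Fin d) → Fin (p ^ (n - d))))

theorem count_codes {D : Type} [Finite D] (G : D → Type) [∀ δ, AddCommGroup (G δ)] (p n t : ℕ)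
    (hp : p.Prime) (ht0 : 0 < t) (ht : n ≤ t * t) (hG : ∀ δ, Nat.card (G δ) = p ^ n)
    (hcl : ∀ (A : Type) [AddCommGroup A], Nat.card A = p ^ n → ∃ δ, Nonempty (A ≃+ G δ)) :
    Finite (Quot (FinCommRingOfCard.Iso (m := p ^ n))) ∧
      ringCount (p ^ n) ≤ Nat.card (Code D p n (6 * t + 1)) := by
  classical
  have hppos : 0 < p ^ n := pow_pos hp.pos n
  have hfinG : ∀ δ, Finite (G δ) := fun δ => Nat.finite_of_card_ne_zero (by rw [hG]; omega)
  have hgen : ∀ δ, ∃ g : Fin n → G δ, AddSubgroup.closure (Set.range g) = ⊤ := fun δ =>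
    exists_fin_gens ⊤ n (el_top_of_card hp (hG δ)).le
  choose g hg using hgen
  have hdec : ∀ δ, Function.Surjective (dec (G δ) (p ^ n)) := fun δ => dec_surj _ _ (hG δ).le
  let P : FinCommRingOfCard (p ^ n) → Code D p n (6 * t + 1) → Prop :=
    fun A ⟨δ, cw, ce, ch, ⟨d, cx, ct⟩⟩ =>
    ∃ (φ : A.carrier ≃+ G δ) (w : Fin (6 * t + 1) → A.carrier) (x : Fin d → A.carrier),
      Spans (Set.range w) (Set.range x) ∧ φ 1 = dec (G δ) (p ^ n) ce ∧
      (∀ i j, φ (w i * φ.symm (g δ j)) = dec (G δ) (p ^ n) (cw i j)) ∧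
      (∀ i, φ (x i) = dec (G δ) (p ^ n) (cx i)) ∧
      (∀ i j, φ (x i * x j) =
        (dec (AddSubgroup.closure (Set.range fun k => dec (G δ) (p ^ n) (ch k))) (p ^ (n - d))
          (ct s(i, j)) : G δ))
  have hex : ∀ A, ∃ c, P A c := by
    intro A
    have hfin : Finite A.carrier := Nat.finite_of_card_ne_zero (by rw [A.card_eq]; omega)
    obtain ⟨δ, ⟨φ⟩⟩ := hcl A.carrier A.card_eq
    obtain ⟨d, hd, H, hHd, S, hS, X, hXd, hXX, hspan⟩ :=
      exists_data (R := A.carrier) n t (el_top_of_card hp A.card_eq).le ht0 ht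
    obtain ⟨w, hw1, hw2⟩ := pad S _ hS
    obtain ⟨x, hx1, hx2⟩ := pad X _ hXd
    have hxH : ∀ i j, x i * x j ∈ H := by
      intro i j
      have hi := hx2 ⟨i, rfl⟩
      have hj := hx2 ⟨j, rfl⟩
      rcases hi with hi | hi
      · rw [hi, zero_mul]; exact H.zero_mem
      · rcases hj with hj | hj
        · rw [hj, mul_zero]; exact H.zero_mem
        · exact hXX _ hi _ hj
    let H' : AddSubgroup (G δ) := H.map φ.toAddMonoidHom
    have hcardH : Nat.card H' = Nat.card H :=
      (Nat.card_congr (φ.addSubgroupMap H).toEquiv).symm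
    obtain ⟨h', hh'⟩ := exists_fin_gens H' n
      ((el_mono le_top).trans (el_top_of_card hp (hG δ)).le)
    choose ch hch using fun k => hdec δ (h' k)
    have hHc : AddSubgroup.closure (Set.range fun k => dec (G δ) (p ^ n) (ch k)) = H' := by
      simp_rw [hch]; exact hh'
    have hsurj : Function.Surjective
        (dec (AddSubgroup.closure (Set.range fun k => dec (G δ) (p ^ n) (ch k))) (p ^ (n - d))) := by
      refine dec_surj _ _ ?_
      rw [hHc, hcardH, card_eq_pow_el hp A.card_eq]
      exact Nat.pow_le_pow_right hp.pos (by omega)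
    have hmem : ∀ i j, φ (x i * x j) ∈
        AddSubgroup.closure (Set.range fun k => dec (G δ) (p ^ n) (ch k)) := by
      intro i j
      rw [hHc]
      exact ⟨_, hxH i j, rfl⟩
    let f : Sym2 (Fin d) → AddSubgroup.closure (Set.range fun k => dec (G δ) (p ^ n) (ch k)) :=
      Sym2.lift ⟨fun i j => ⟨φ (x i * x j), hmem i j⟩, fun i j => by simp [mul_comm]⟩
    choose ct hct using fun σ => hsurj (f σ)
    choose ce hce using hdec δ (φ 1)
    choose cw hcw using fun i j => hdec δ (φ (w i * φ.symm (g δ j)))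
    choose cx hcx using fun i => hdec δ (φ (x i))
    refine ⟨⟨δ, cw, ce, ch, ⟨⟨d, by omega⟩, cx, ct⟩⟩, φ, w, x, ?_, hce.symm,
      fun i j => (hcw i j).symm, fun i => (hcx i).symm, ?_⟩
    · intro T h1 h2 h3
      exact hspan T h1 (hx1.trans h2) (fun s hs => h3 s (hw1 hs))
    · intro i j
      have := congrArg Subtype.val (hct s(i, j))
      exact this.symm
  have huniq : ∀ A B c, P A c → P B c → FinCommRingOfCard.Iso A B := by
    rintro A B ⟨δ, cw, ce, ch, ⟨d, cx, ct⟩⟩ ⟨φ, w, x, hs, h1, hw, hx, hxx⟩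
      ⟨φ', w', x', hs', h1', hw', hx', hxx'⟩
    let ψ := φ.trans φ'.symm
    have hψ : ∀ a, ψ a = φ'.symm (φ a) := fun a => rfl
    refine ⟨{ ψ with map_mul' := determined ψ w w' x x' hs ?_ ?_ ?_ ?_ }⟩
    · rw [hψ, h1, ← h1', AddEquiv.symm_apply_apply]
    · intro i a
      let f1 : G δ →+ G δ := (φ.toAddMonoidHom.comp (AddMonoidHom.mulLeft (w i))).comp
        φ.symm.toAddMonoidHom
      let f2 : G δ →+ G δ := (φ'.toAddMonoidHom.comp (AddMonoidHom.mulLeft (w' i))).comp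
        φ'.symm.toAddMonoidHom
      have hf : f1 = f2 := by
        refine AddMonoidHom.eq_of_eqOn_dense (hg δ) ?_
        rintro _ ⟨j, rfl⟩
        exact (hw i j).trans (hw' i j).symm
      have := DFunLike.congr_fun hf (φ a)
      have h3 : φ (w i * a) = φ' (w' i * φ'.symm (φ a)) := by
        have h4 : f1 (φ a) = φ (w i * φ.symm (φ a)) := rfl
        rw [AddEquiv.symm_apply_apply] at h4
        rw [← h4, this]; rfl
      rw [hψ, hψ, h3, AddEquiv.symm_apply_apply]
    · intro i
      rw [hψ, hx, ← hx', AddEquiv.symm_apply_apply]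
    · intro i j
      rw [hψ, hxx, ← hxx', AddEquiv.symm_apply_apply]
  refine card_le_of_code (fun q c => P q.out c) (fun q => hex q.out) ?_
  intro q q' c h h'
  rw [← Quot.out_eq q, ← Quot.out_eq q']
  exact Quot.sound (huniq _ _ c h h')

/-- codes for abelian groups -/
abbrev DG (n : ℕ) : Type := Σ k : Fin (n + 1), (Fin k → Fin (n + 1))

abbrev GG (p : ℕ) {n : ℕ} (δ : DG n) : Type := ∀ i : Fin δ.1, ZMod (p ^ (δ.2 i : ℕ))

lemma classify (p n : ℕ) (hp : p.Prime) (A : Type) [AddCommGroup A] (hA : Nat.card A = p ^ n) :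
    ∃ δ : DG n, Nonempty (A ≃+ GG p δ) := by
  classical
  have hfin : Finite A := Nat.finite_of_card_ne_zero (by rw [hA]; exact (pow_pos hp.pos n).ne')
  obtain ⟨ι, hι, m, hm, ⟨e⟩⟩ := AddCommGroup.equiv_directSum_zmod_of_finite' A
  let e1 : A ≃+ ∀ i, ZMod (m i) := e.trans (DirectSum.addEquivProd _)
  have hcard : ∏ i, m i = p ^ n := by
    rw [← hA, Nat.card_congr e1.toEquiv, Nat.card_pi]
    simp
  have hk : Fintype.card ι ≤ n := by
    have := card_le_Omega Finset.univ m hm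
    rw [hcard, cardFactors_apply_prime_pow hp] at this
    simpa using this
  have hma : ∀ i, ∃ a ≤ n, m i = p ^ a := fun i =>
    (Nat.dvd_prime_pow hp).1 (hcard ▸ Finset.dvd_prod_of_mem m (Finset.mem_univ i))
  choose a ha hma using hma
  let ε := Fintype.equivFin ι
  refine ⟨⟨⟨Fintype.card ι, by omega⟩, fun j => ⟨a (ε.symm j), by have := ha (ε.symm j); omega⟩⟩, ⟨?_⟩⟩
  have hm' : m = fun i => p ^ a i := funext hma
  subst hm'
  let e2 : (∀ i, ZMod (p ^ a i)) ≃+ (∀ j : Fin (Fintype.card ι), ZMod (p ^ a (ε.symm j))) :=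
    { (Equiv.piCongrLeft' (fun i => ZMod (p ^ a i)) ε) with
      map_add' := by intro x y; funext j; rfl }
  exact e1.trans e2

theorem count_codes' (p n t : ℕ) (hp : p.Prime) (ht0 : 0 < t) (ht : n ≤ t * t) :
    Finite (Quot (FinCommRingOfCard.Iso (m := p ^ n))) ∧
      ringCount (p ^ n) ≤ Nat.card (Code (DG n) p n (6 * t + 1)) := by
  have h := count_codes (D := {δ : DG n // Nat.card (GG p δ) = p ^ n}) (fun δ => GG p δ.1) p n t
    hp ht0 ht (fun δ => δ.2) (by
      intro A _ hA
      obtain ⟨δ, ⟨e⟩⟩ := classify p n hp A hA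
      exact ⟨⟨δ, by rw [← hA]; exact (Nat.card_congr e.toEquiv).symm⟩, ⟨e⟩⟩)
  refine ⟨h.1, h.2.trans ?_⟩
  refine Nat.card_le_card_of_injective (fun c => (c.1.1, c.2)) ?_
  rintro ⟨⟨a, ha⟩, b⟩ ⟨⟨a', ha'⟩, b'⟩ h
  simp at h
  obtain ⟨rfl, rfl⟩ := h
  rfl

end codes

section lower

variable {p d r : ℕ}

abbrev Tab (p d r : ℕ) : Type := Fin r → Sym2 (Fin d) → ZMod p
abbrev LG (p d r : ℕ) : Type := ZMod p × (Fin d → ZMod p) × (Fin r → ZMod p)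

def bil (β : Tab p d r) (v v' : Fin d → ZMod p) : Fin r → ZMod p :=
  fun k => ∑ i, ∑ j, β k s(i, j) * v i * v' j

lemma bil_comm (β : Tab p d r) (v v' : Fin d → ZMod p) : bil β v v' = bil β v' v := by
  funext k
  unfold bil
  rw [Finset.sum_comm]
  refine Finset.sum_congr rfl fun i _ => Finset.sum_congr rfl fun j _ => ?_
  rw [Sym2.eq_swap]; ring

lemma bil_add (β : Tab p d r) (v w w' : Fin d → ZMod p) :
    bil β v (w + w') = bil β v w + bil β v w' := by
  funext k
  simp only [bil, Pi.add_apply, mul_add, Finset.sum_add_distrib]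

lemma bil_smul (β : Tab p d r) (a : ZMod p) (v w : Fin d → ZMod p) :
    bil β v (a • w) = a • bil β v w := by
  funext k
  simp only [bil, Pi.smul_apply, smul_eq_mul, Finset.mul_sum]
  refine Finset.sum_congr rfl fun i _ => Finset.sum_congr rfl fun j _ => ?_
  ring

lemma bil_add' (β : Tab p d r) (v w w' : Fin d → ZMod p) :
    bil β (w + w') v = bil β w v + bil β w' v := by
  rw [bil_comm, bil_add, bil_comm β v, bil_comm β v]

lemma bil_smul' (β : Tab p d r) (a : ZMod p) (v w : Fin d → ZMod p) :
    bil β (a • w) v = a • bil β w v := by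
  rw [bil_comm, bil_smul, bil_comm β v]

lemma bil_single (β : Tab p d r) (i j : Fin d) (k : Fin r) :
    bil β (Pi.single i 1) (Pi.single j 1) k = β k s(i, j) := by
  unfold bil
  rw [Finset.sum_eq_single i, Finset.sum_eq_single j]
  · simp
  · intro b _ hb; simp [Pi.single_eq_of_ne hb]
  · simp
  · intro b _ hb; simp [Pi.single_eq_of_ne hb]
  · simp

/-- the ring attached to a table -/
def LB (_ : Tab p d r) : Type := LG p d r

instance (β : Tab p d r) : AddCommGroup (LB β) := inferInstanceAs (AddCommGroup (LG p d r))

def LB.mk (β : Tab p d r) (x : LG p d r) : LB β := x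
def LB.un {β : Tab p d r} (x : LB β) : LG p d r := x

def lmul (β : Tab p d r) (x y : LG p d r) : LG p d r :=
  (x.1 * y.1, x.1 • y.2.1 + y.1 • x.2.1, x.1 • y.2.2 + y.1 • x.2.2 + bil β x.2.1 y.2.1)

lemma lmul_comm (β : Tab p d r) (x y : LG p d r) : lmul β x y = lmul β y x := by
  unfold lmul
  refine Prod.ext (mul_comm _ _) (Prod.ext (add_comm _ _) ?_)
  simp only
  rw [bil_comm, add_comm (x.1 • y.2.2)]

lemma lmul_add (β : Tab p d r) (x y z : LG p d r) :
    lmul β x (y + z) = lmul β x y + lmul β x z := by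
  unfold lmul
  refine Prod.ext ?_ (Prod.ext ?_ ?_)
  · simp [mul_add]
  · simp only [Prod.fst_add, Prod.snd_add]; module
  · simp only [Prod.fst_add, Prod.snd_add, bil_add]; module

lemma lmul_assoc (β : Tab p d r) (x y z : LG p d r) :
    lmul β (lmul β x y) z = lmul β x (lmul β y z) := by
  unfold lmul
  refine Prod.ext ?_ (Prod.ext ?_ ?_)
  · simp [mul_assoc]
  · simp only; module
  · simp only [bil_add, bil_smul, bil_add', bil_smul']; module

lemma one_lmul (β : Tab p d r) (x : LG p d r) : lmul β (1, 0, 0) x = x := by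
  unfold lmul
  have : bil β 0 x.2.1 = 0 := by
    have := bil_smul' β 0 x.2.1 0
    simpa using this
  refine Prod.ext ?_ (Prod.ext ?_ ?_)
  · simp
  · simp
  · simp [this]

lemma add_lmul (β : Tab p d r) (x y z : LG p d r) :
    lmul β (x + y) z = lmul β x z + lmul β y z := by
  rw [lmul_comm β _ z, lmul_comm β x z, lmul_comm β y z]
  exact lmul_add β z x y

lemma lmul_zero (β : Tab p d r) (x : LG p d r) : lmul β x 0 = 0 := by
  have h := lmul_add β x 0 0
  rw [add_zero] at h
  exact left_eq_add.1 h

instance (β : Tab p d r) : CommRing (LB β) :=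
  { (inferInstance : AddCommGroup (LB β)) with
    mul := fun x y => lmul β x y
    one := ((1, 0, 0) : LG p d r)
    mul_assoc := lmul_assoc β
    one_mul := one_lmul β
    mul_one := fun x => (lmul_comm β _ _).trans (one_lmul β x)
    left_distrib := lmul_add β
    right_distrib := add_lmul β
    zero_mul := fun x => (lmul_comm β _ _).trans (lmul_zero β x)
    mul_zero := lmul_zero β
    mul_comm := lmul_comm β }

theorem lower_count (p n : ℕ) (hp : p.Prime) (hn : 1 + d + r = n)
    (hfin : Finite (Quot (FinCommRingOfCard.Iso (m := p ^ n)))) :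
    p ^ (r * (d + 1).choose 2) ≤ ringCount (p ^ n) * p ^ (n * n) := by
  classical
  have : NeZero p := ⟨hp.ne_zero⟩
  have hppos : 0 < p ^ n := pow_pos hp.pos n
  have hcard : Nat.card (LG p d r) = p ^ n := by
    rw [Nat.card_eq_fintype_card]
    simp [LG, ZMod.card]
    rw [← hn]; ring
  have hfinA : ∀ A : FinCommRingOfCard (p ^ n), Finite A.carrier :=
    fun A => Nat.finite_of_card_ne_zero (by rw [A.card_eq]; omega)
  let F : Tab p d r → FinCommRingOfCard (p ^ n) := fun β => ⟨LB β, hcard⟩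
  obtain ⟨g, hg⟩ := exists_fin_gens (⊤ : AddSubgroup (LG p d r)) n (el_top_of_card hp hcard).le
  let P : Tab p d r → Quot (FinCommRingOfCard.Iso (m := p ^ n)) × (Fin n → Fin (p ^ n)) → Prop :=
    fun β c => ∃ φ : LB β ≃+* c.1.out.carrier,
      ∀ i, φ (LB.mk β (g i)) = dec c.1.out.carrier (p ^ n) (c.2 i)
  have hex : ∀ β, ∃ c, P β c := by
    intro β
    have h1 : Nonempty (LB β ≃+* (Quot.mk FinCommRingOfCard.Iso (F β)).out.carrier) := by
      have h2 := Quot.out_eq (Quot.mk FinCommRingOfCard.Iso (F β))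
      have h3 := Quot.eqvGen_exact h2
      have hequiv : Equivalence (FinCommRingOfCard.Iso (m := p ^ n)) :=
        ⟨fun A => ⟨RingEquiv.refl _⟩, fun ⟨e⟩ => ⟨e.symm⟩, fun ⟨e⟩ ⟨e'⟩ => ⟨e.trans e'⟩⟩
      rw [hequiv.eqvGen_iff] at h3
      exact ⟨h3.some.symm⟩
    obtain ⟨φ⟩ := h1
    choose c hc using fun i => dec_surj (Quot.mk FinCommRingOfCard.Iso (F β)).out.carrier (p ^ n)
      (Quot.mk FinCommRingOfCard.Iso (F β)).out.card_eq.le (φ (LB.mk β (g i)))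
    exact ⟨(_, c), φ, fun i => (hc i).symm⟩
  have huniq : ∀ β β' c, P β c → P β' c → β = β' := by
    rintro β β' c ⟨φ, hφ⟩ ⟨φ', hφ'⟩
    let f1 : LG p d r →+ c.1.out.carrier :=
      { toFun := fun x => φ (LB.mk β x)
        map_zero' := map_zero φ
        map_add' := fun x y => map_add φ (LB.mk β x) (LB.mk β y) }
    let f2 : LG p d r →+ c.1.out.carrier :=
      { toFun := fun x => φ' (LB.mk β' x)
        map_zero' := map_zero φ'
        map_add' := fun x y => map_add φ' (LB.mk β' x) (LB.mk β' y) }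
    have hf : f1 = f2 := by
      refine AddMonoidHom.eq_of_eqOn_dense hg ?_
      rintro _ ⟨i, rfl⟩
      exact (hφ i).trans (hφ' i).symm
    have hff : ∀ x, φ (LB.mk β x) = φ' (LB.mk β' x) := fun x => DFunLike.congr_fun hf x
    have hmul : ∀ x y, lmul β x y = lmul β' x y := by
      intro x y
      have h1 : φ (LB.mk β (lmul β x y)) = φ (LB.mk β x) * φ (LB.mk β y) :=
        map_mul φ (LB.mk β x) (LB.mk β y)
      have h2 : φ' (LB.mk β' (lmul β' x y)) = φ' (LB.mk β' x) * φ' (LB.mk β' y) :=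
        map_mul φ' (LB.mk β' x) (LB.mk β' y)
      rw [hff, hff, hff, ← h2] at h1
      exact φ'.injective h1
    funext k σ
    induction σ using Sym2.ind with
    | _ i j =>
      have := hmul (0, Pi.single i 1, 0) (0, Pi.single j 1, 0)
      have h3 := congrFun (congrArg (fun x : LG p d r => x.2.2) this) k
      simp only [lmul, Pi.add_apply, bil_single] at h3
      simpa using h3
  have h := (card_le_of_code P hex huniq).2
  have h4 : Nat.card (Tab p d r) = p ^ (r * (d + 1).choose 2) := by
    rw [Nat.card_eq_fintype_card]
    simp [Tab, ZMod.card, Sym2.card]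
    rw [← pow_mul, mul_comm]
  rw [h4, Nat.card_prod] at h
  have h5 : Nat.card (Fin n → Fin (p ^ n)) = p ^ (n * n) := by
    rw [Nat.card_eq_fintype_card]; simp [← pow_mul]
  rw [h5] at h
  exact h

end lower

section upper

theorem upper_count (p n t : ℕ) (hp : p.Prime) (ht0 : 0 < t) (ht : n ≤ t * t) :
    ∃ d ≤ n, ringCount (p ^ n) ≤
      p ^ (n * (n + 1) + n * n * (6 * t + 1) + n + n * n + n + n * n
        + (n - d) * (d + 1).choose 2) := by
  classical
  obtain ⟨d, hd, hmax⟩ := Finset.exists_max_image (Finset.range (n + 1))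
    (fun d => (n - d) * (d + 1).choose 2) ⟨0, by simp⟩
  refine ⟨d, by simpa [Nat.lt_succ_iff] using hd, (count_codes' p n t hp ht0 ht).2.trans ?_⟩
  set M := (n - d) * (d + 1).choose 2 with hM
  have hn1 : n + 1 ≤ p ^ n := by
    calc n + 1 ≤ 2 ^ n := Nat.lt_two_pow_self
      _ ≤ p ^ n := Nat.pow_le_pow_left hp.two_le n
  have h1 : Nat.card (DG n) ≤ p ^ (n * (n + 1)) := by
    rw [Nat.card_eq_fintype_card, Fintype.card_sigma]
    calc ∑ k : Fin (n + 1), Fintype.card (Fin k → Fin (n + 1))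
        ≤ ∑ k : Fin (n + 1), (n + 1) ^ n := by
          refine Finset.sum_le_sum fun k _ => ?_
          simp only [Fintype.card_fun, Fintype.card_fin]
          exact Nat.pow_le_pow_right (by omega) (by omega)
      _ = (n + 1) ^ (n + 1) := by simp [pow_succ, mul_comm]
      _ ≤ (p ^ n) ^ (n + 1) := Nat.pow_le_pow_left hn1 _
      _ = p ^ (n * (n + 1)) := by rw [← pow_mul]
  have h2 : Nat.card (Fin (6 * t + 1) → Fin n → Fin (p ^ n)) = p ^ (n * n * (6 * t + 1)) := by
    rw [Nat.card_eq_fintype_card]; simp [← pow_mul, mul_assoc]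
  have h3 : Nat.card (Fin n → Fin (p ^ n)) = p ^ (n * n) := by
    rw [Nat.card_eq_fintype_card]; simp [← pow_mul]
  have h4 : Nat.card (Σ d : Fin (n + 1),
      (Fin d → Fin (p ^ n)) × (Sym2 (Fin d) → Fin (p ^ (n - d)))) ≤ p ^ (n + n * n + M) := by
    rw [Nat.card_eq_fintype_card, Fintype.card_sigma]
    calc _ ≤ ∑ k : Fin (n + 1), p ^ (n * n + M) := by
          refine Finset.sum_le_sum fun k _ => ?_
          simp only [Fintype.card_prod, Fintype.card_fun, Fintype.card_fin, Sym2.card]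
          rw [← pow_mul, ← pow_mul, ← pow_add]
          refine Nat.pow_le_pow_right hp.pos ?_
          refine Nat.add_le_add (Nat.mul_le_mul_left n (by omega)) ?_
          exact hmax k (Finset.mem_range.2 k.2)
      _ = (n + 1) * p ^ (n * n + M) := by simp
      _ ≤ p ^ n * p ^ (n * n + M) := Nat.mul_le_mul_right _ hn1
      _ = p ^ (n + n * n + M) := by rw [← pow_add, add_assoc]
  rw [Nat.card_prod, Nat.card_prod, Nat.card_prod, Nat.card_prod, h2, h3, Nat.card_fin]
  calc _ ≤ p ^ (n * (n + 1)) * (p ^ (n * n * (6 * t + 1)) * (p ^ n * (p ^ (n * n) *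
        p ^ (n + n * n + M)))) := by gcongr
    _ = _ := by simp only [← pow_add]; congr 1; ring

end upper

section final

lemma choose_real (d : ℕ) : (((d + 1).choose 2 : ℕ) : ℝ) = (d : ℝ) * (d + 1) / 2 := by
  rw [Nat.cast_choose_two]; push_cast; ring

lemma sq_le_pow (n : ℕ) (hn : 1 ≤ n) : (n : ℝ) ^ 2 ≤ (n : ℝ) ^ ((8 : ℝ) / 3) := by
  have h1 : (1 : ℝ) ≤ n := by exact_mod_cast hn
  rw [← Real.rpow_natCast (n : ℝ) 2]
  exact Real.rpow_le_rpow_of_exponent_le h1 (by norm_num)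

lemma sqrt_le_pow (n : ℕ) (hn : 1 ≤ n) : (n : ℝ) ^ 2 * √n ≤ (n : ℝ) ^ ((8 : ℝ) / 3) := by
  have h1 : (1 : ℝ) ≤ n := by exact_mod_cast hn
  rw [← Real.rpow_natCast (n : ℝ) 2, Real.sqrt_eq_rpow, ← Real.rpow_add (by linarith)]
  exact Real.rpow_le_rpow_of_exponent_le h1 (by norm_num)

lemma cubic (n d : ℝ) (hn : 0 ≤ n) (hd : 0 ≤ d) : (n - d) * d ^ 2 ≤ 4 / 27 * n ^ 3 := by
  have : 0 ≤ (2 * n - 3 * d) ^ 2 * (n + 3 * d) := by positivity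
  nlinarith

theorem upper_final (p n : ℕ) (hp : p.Prime) (hn : 1 ≤ n) :
    (ringCount (p ^ n) : ℝ)
      ≤ (p : ℝ) ^ ((2 / 27 : ℝ) * (n : ℝ) ^ 3 + 30 * (n : ℝ) ^ ((8 : ℝ) / 3)) := by
  obtain ⟨d, hd, h⟩ := upper_count p n (Nat.sqrt n + 1) hp (by omega) (Nat.lt_succ_sqrt n).le
  have hp1 : (1 : ℝ) ≤ p := by exact_mod_cast hp.one_lt.le
  have h' : (ringCount (p ^ n) : ℝ) ≤ (p : ℝ) ^ (n * (n + 1) + n * n * (6 * (Nat.sqrt n + 1) + 1)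
      + n + n * n + n + n * n + (n - d) * (d + 1).choose 2) := by exact_mod_cast h
  refine h'.trans ?_
  rw [← Real.rpow_natCast]
  refine Real.rpow_le_rpow_of_exponent_le hp1 ?_
  push_cast [Nat.cast_sub hd]
  rw [choose_real]
  have h1 : (1 : ℝ) ≤ n := by exact_mod_cast hn
  have h2 := sq_le_pow n hn
  have h3 := sqrt_le_pow n hn
  have h4 : ((Nat.sqrt n : ℕ) : ℝ) ≤ √n := Real.nat_sqrt_le_real_sqrt
  have hd0 : (0 : ℝ) ≤ d := by positivity
  have hdn : (d : ℝ) ≤ n := by exact_mod_cast hd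
  have h5 := cubic n d (by linarith) hd0
  have h6 : (n : ℝ) ^ 2 * (Nat.sqrt n : ℕ) ≤ (n : ℝ) ^ 2 * √n :=
    mul_le_mul_of_nonneg_left h4 (by positivity)
  have h7 : ((n : ℝ) - d) * d ≤ n ^ 2 := by nlinarith
  have h8 : (n : ℝ) ≤ n ^ 2 := by nlinarith
  nlinarith

theorem lower_final (p n : ℕ) (hp : p.Prime) (hn : 1 ≤ n) :
    (p : ℝ) ^ ((2 / 27 : ℝ) * (n : ℝ) ^ 3 - 30 * (n : ℝ) ^ ((8 : ℝ) / 3))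
      ≤ (ringCount (p ^ n) : ℝ) := by
  have hfin := (count_codes' p n (Nat.sqrt n + 1) hp (by omega)
    (Nat.lt_succ_sqrt n).le).1
  obtain ⟨r, d, hrd, hr, hd⟩ : ∃ r d : ℕ, 1 + d + r = n ∧ n ≤ 3 * r + 3 ∧ 2 * (n - 1) ≤ 3 * d :=
    ⟨(n - 1) / 3, n - 1 - (n - 1) / 3, by omega, by omega, by omega⟩
  have h := lower_count p n hp hrd hfin
  have hp0 : (0 : ℝ) < p := by exact_mod_cast hp.pos
  have hp1 : (1 : ℝ) ≤ p := by exact_mod_cast hp.one_lt.le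
  have h' : (p : ℝ) ^ (r * (d + 1).choose 2) ≤ (ringCount (p ^ n) : ℝ) * (p : ℝ) ^ (n * n) := by
    exact_mod_cast h
  rw [← Real.rpow_natCast, ← Real.rpow_natCast] at h'
  have h9 : (p : ℝ) ^ (((r * (d + 1).choose 2 : ℕ) : ℝ) - ((n * n : ℕ) : ℝ))
      ≤ (ringCount (p ^ n) : ℝ) := by
    rw [Real.rpow_sub hp0, div_le_iff₀ (Real.rpow_pos_of_pos hp0 _)]
    exact h'
  refine le_trans (Real.rpow_le_rpow_of_exponent_le hp1 ?_) h9
  push_cast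
  rw [choose_real]
  have h1 : (1 : ℝ) ≤ n := by exact_mod_cast hn
  have h2 := sq_le_pow n hn
  have hr' : (n : ℝ) ≤ 3 * r + 3 := by exact_mod_cast hr
  have hd' : 2 * ((n : ℝ) - 1) ≤ 3 * d := by
    have : 2 * n ≤ 3 * d + 2 := by omega
    have : 2 * (n : ℝ) ≤ 3 * d + 2 := by exact_mod_cast this
    linarith
  have hr0 : (0 : ℝ) ≤ r := by positivity
  have hd0 : (0 : ℝ) ≤ d := by positivity
  have e1 : (2 * ((n : ℝ) - 1)) ^ 2 ≤ (3 * d) ^ 2 := pow_le_pow_left₀ (by linarith) hd' 2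
  have e2 : (r : ℝ) * (2 * ((n : ℝ) - 1)) ^ 2 ≤ r * (3 * d) ^ 2 := mul_le_mul_of_nonneg_left e1 hr0
  have e3 : ((n : ℝ) - 3) * (2 * ((n : ℝ) - 1)) ^ 2 ≤ 3 * r * (2 * ((n : ℝ) - 1)) ^ 2 :=
    mul_le_mul_of_nonneg_right (by linarith) (by positivity)
  have e4 : 0 ≤ (r : ℝ) * d := by positivity
  nlinarith

end final

end RC

/-- There is a constant `C > 0` such that for every prime `p` and every `n ≥ 1`,
the number `R(pⁿ)` of isomorphism classes of finite commutative rings of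
cardinality `pⁿ` satisfies
`p^((2/27)n³ - C n^(8/3)) ≤ R(pⁿ) ≤ p^((2/27)n³ + C n^(8/3))`. -/
theorem stmt1 :
    ∃ C : ℝ, 0 < C ∧
      ∀ (p n : ℕ), p.Prime → 1 ≤ n →
        (p : ℝ) ^ ((2 / 27 : ℝ) * (n : ℝ) ^ 3 - C * (n : ℝ) ^ ((8 : ℝ) / 3))
            ≤ (ringCount (p ^ n) : ℝ) ∧
        (ringCount (p ^ n) : ℝ)
            ≤ (p : ℝ) ^ ((2 / 27 : ℝ) * (n : ℝ) ^ 3 + C * (n : ℝ) ^ ((8 : ℝ) / 3)) := by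
  exact ⟨30, by norm_num, fun p n hp hn => ⟨RC.lower_final p n hp hn, RC.upper_final p n hp hn⟩⟩
end

section
/- There exists a constant C > 0 such that for every integer N ≥ 2, the number T(N) of isomorphism classes of finite commutative rings of cardinality at most N satisfies |log T(N) - (2/27)(log N)^3/(log 2)^2| ≤ C (log N)^{8/3}. -/
/-- A finite commutative (unital) ring of cardinality at most `N`, bundled with
its carrier type.  (`0 < Nat.card carrier` forces the carrier to be finite and
nonempty, since `Nat.card` of an infinite type is `0`.) -/
structure FinCommRingLE (N : ℕ) : Type 1 where
  carrier : Type
  [commRing : CommRing carrier]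
  card_pos : 0 < Nat.card carrier
  card_le : Nat.card carrier ≤ N

attribute [instance] FinCommRingLE.commRing

/-- Two bundled rings are isomorphic when there is a ring isomorphism between them. -/
def FinCommRingLE.Iso {N : ℕ} (A B : FinCommRingLE N) : Prop :=
  Nonempty (A.carrier ≃+* B.carrier)

/-- `T N` is the number of isomorphism classes of finite commutative rings of
cardinality at most `N`. -/
noncomputable def ringCountLE (N : ℕ) : ℕ :=
  Nat.card (Quot (FinCommRingLE.Iso (N := N)))


theorem rc_gen_aux {A : Type*} [AddCommGroup A] [Finite A] (H : AddSubgroup A) :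
    ∀ (m : ℕ) (K : AddSubgroup A), K ≤ H → Nat.card H - Nat.card K ≤ m →
    ∃ (a : ℕ) (w : Fin a → A), H = K ⊔ AddSubgroup.closure (Set.range w) ∧
      2 ^ a * Nat.card K ≤ Nat.card H := by
  intro m
  induction m with
  | zero =>
    intro K hK hc
    refine ⟨0, Fin.elim0, ?_, ?_⟩
    · have : K = H := AddSubgroup.eq_of_le_of_card_ge hK (by omega)
      simp [this, Set.range_eq_empty]
    · simpa using AddSubgroup.card_le_of_le hK
  | succ m ih =>
    intro K hK hc
    by_cases h : K = H
    · subst h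
      refine ⟨0, Fin.elim0, ?_, ?_⟩
      · simp [Set.range_eq_empty]
      · simp
    · obtain ⟨x, hx, hxK⟩ : ∃ x ∈ H, x ∉ K := by
        by_contra hcon
        push Not at hcon
        exact h (le_antisymm hK hcon)
      set K' := K ⊔ AddSubgroup.closure {x} with hK'
      have hle : K' ≤ H := sup_le hK (by simpa using hx)
      have hKK' : K ≤ K' := le_sup_left
      have hxK' : x ∈ K' := (le_sup_right : _ ≤ K') (AddSubgroup.subset_closure (by simp))
      have hdvd : Nat.card K ∣ Nat.card K' := AddSubgroup.card_dvd_of_le hKK'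
      have hne : Nat.card K ≠ Nat.card K' := by
        intro he
        have : K = K' := AddSubgroup.eq_of_le_of_card_ge hKK' he.ge
        exact hxK (this ▸ hxK')
      have hpos : 0 < Nat.card K' := Nat.card_pos
      have hpos' : 0 < Nat.card K := Nat.card_pos
      obtain ⟨q, hq⟩ := hdvd
      have hq2 : 2 ≤ q := by
        rcases q with _ | _ | q
        · omega
        · omega
        · omega
      have h2 : 2 * Nat.card K ≤ Nat.card K' := by rw [hq]; nlinarith
      have h3 := AddSubgroup.card_le_of_le hle
      obtain ⟨a, w, hw, hcard⟩ := ih K' hle (by omega)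
      refine ⟨a + 1, Fin.cons x w, ?_, ?_⟩
      · rw [hw, hK', Fin.range_cons, Set.insert_eq, AddSubgroup.closure_union, sup_assoc]
      · calc 2 ^ (a + 1) * Nat.card K = 2 ^ a * (2 * Nat.card K) := by ring
          _ ≤ 2 ^ a * Nat.card K' := by gcongr
          _ ≤ _ := hcard

theorem rc_gen {A : Type*} [AddCommGroup A] [Finite A] (H K : AddSubgroup A) (hK : K ≤ H) :
    ∃ (a : ℕ) (w : Fin a → A), H = K ⊔ AddSubgroup.closure (Set.range w) ∧
      2 ^ a * Nat.card K ≤ Nat.card H :=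
  rc_gen_aux H _ K hK le_rfl

theorem rc_pad {A : Type*} [AddCommGroup A] {a t : ℕ} (h : a ≤ t) (w : Fin a → A) :
    ∃ v : Fin t → A, AddSubgroup.closure (Set.range v) = AddSubgroup.closure (Set.range w) := by
  refine ⟨fun i => if hi : i.1 < a then w ⟨i, hi⟩ else 0, le_antisymm ?_ ?_⟩
  · rw [AddSubgroup.closure_le]
    rintro _ ⟨i, rfl⟩
    by_cases hi : i.1 < a
    · simp only [hi, dite_true]
      exact AddSubgroup.subset_closure ⟨_, rfl⟩
    · simp only [hi, dite_false]
      exact AddSubgroup.zero_mem _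
  · apply AddSubgroup.closure_mono
    rintro _ ⟨i, rfl⟩
    exact ⟨⟨i, lt_of_lt_of_le i.2 h⟩, by simp⟩

/-- relative generation by few elements -/
theorem rc_gen_pad {A : Type*} [AddCommGroup A] [Finite A] (H K : AddSubgroup A) (hK : K ≤ H)
    (t : ℕ) (ht : Nat.card H < 2 ^ (t + 1) * Nat.card K) :
    ∃ w : Fin t → A, H = K ⊔ AddSubgroup.closure (Set.range w) := by
  obtain ⟨a, w, hw, hc⟩ := rc_gen H K hK
  have : a < t + 1 := by
    have hpos' : 0 < Nat.card K := Nat.card_pos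
    have := lt_of_le_of_lt hc ht
    have := Nat.lt_of_mul_lt_mul_right this
    exact (Nat.pow_lt_pow_iff_right (by norm_num)).1 this
  obtain ⟨v, hv⟩ := rc_pad (Nat.lt_succ_iff.1 this) w
  exact ⟨v, by rw [hv, hw]⟩

theorem rc_gen_bot {A : Type*} [AddCommGroup A] [Finite A] (H : AddSubgroup A)
    (t : ℕ) (ht : Nat.card A < 2 ^ (t + 1)) :
    ∃ w : Fin t → A, AddSubgroup.closure (Set.range w) = H := by
  have := AddSubgroup.card_le_card_addGroup H
  obtain ⟨w, hw⟩ := rc_gen_pad H ⊥ bot_le t (by simp; omega)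
  exact ⟨w, by rw [hw]; simp⟩

/-- multiplications making `A` a commutative ring -/
structure IsRingMul {A : Type*} [AddCommGroup A] (μ : A →+ A →+ A) : Prop where
  comm : ∀ x y, μ x y = μ y x
  assoc : ∀ x y z, μ (μ x y) z = μ x (μ y z)
  one : ∃ o, ∀ x, μ o x = x

/-- the ring given by a multiplication -/
@[reducible] noncomputable def IsRingMul.ring {A : Type*} [AddCommGroup A] {μ : A →+ A →+ A}
    (h : IsRingMul μ) : CommRing A :=
  { ‹AddCommGroup A› with
    mul := fun x y => μ x y
    one := h.one.choose
    mul_comm := h.comm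
    mul_assoc := h.assoc
    one_mul := h.one.choose_spec
    mul_one := fun x => (h.comm _ _).trans (h.one.choose_spec x)
    left_distrib := fun x y z => map_add (μ x) y z
    right_distrib := fun x y z => by
      change μ (x + y) z = μ x z + μ y z
      simp
    zero_mul := fun x => by
      change μ 0 x = 0
      simp
    mul_zero := fun x => by
      change μ x 0 = 0
      simp }

/-- Greedy choice. -/
theorem rc_greedy {R : Type*} [CommRing R] [Finite R] (J : AddSubgroup R) (t : ℕ) (m : ℕ) :
    ∃ z : Fin m → R, (∀ l, z l ∈ J) ∧
      ((∀ x ∈ J, Nat.card ((⨆ l, J.map (AddMonoidHom.mulLeft (z l)) : AddSubgroup R) ⊔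
          J.map (AddMonoidHom.mulLeft x) : AddSubgroup R)
        ≤ 2 ^ t * Nat.card (⨆ l, J.map (AddMonoidHom.mulLeft (z l)) : AddSubgroup R)) ∨
       2 ^ (t * m) ≤ Nat.card (⨆ l, J.map (AddMonoidHom.mulLeft (z l)) : AddSubgroup R)) := by
  induction m with
  | zero =>
    refine ⟨Fin.elim0, fun l => l.elim0, Or.inr ?_⟩
    simp [iSup_of_empty]
  | succ m ih =>
    obtain ⟨z, hz, h⟩ := ih
    have key : ∀ x : R, (⨆ l, J.map (AddMonoidHom.mulLeft ((Fin.snoc z x : Fin (m + 1) → R) l)) : AddSubgroup R)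
        = (⨆ l, J.map (AddMonoidHom.mulLeft (z l)) : AddSubgroup R) ⊔ J.map (AddMonoidHom.mulLeft x) := by
      intro x
      apply le_antisymm
      · refine iSup_le fun l => ?_
        refine Fin.lastCases ?_ (fun i => ?_) l
        · simp only [Fin.snoc_last]; exact le_sup_right
        · simp only [Fin.snoc_castSucc]
          exact le_sup_of_le_left (le_iSup (fun l => J.map (AddMonoidHom.mulLeft (z l))) i)
      · refine sup_le (iSup_le fun l => ?_) ?_
        · refine le_iSup_of_le l.castSucc ?_
          simp only [Fin.snoc_castSucc]; exact le_rfl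
        · refine le_iSup_of_le (Fin.last m) ?_
          simp only [Fin.snoc_last]; exact le_rfl
    have memJ : ∀ x ∈ J, ∀ l, (Fin.snoc z x : Fin (m + 1) → R) l ∈ J := by
      intro x hx l
      refine Fin.lastCases ?_ (fun i => ?_) l
      · simpa using hx
      · simpa using hz i
    by_cases hg : ∀ x ∈ J, Nat.card ((⨆ l, J.map (AddMonoidHom.mulLeft (z l)) : AddSubgroup R) ⊔
          J.map (AddMonoidHom.mulLeft x) : AddSubgroup R)
        ≤ 2 ^ t * Nat.card (⨆ l, J.map (AddMonoidHom.mulLeft (z l)) : AddSubgroup R)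
    · refine ⟨Fin.snoc z 0, memJ 0 J.zero_mem, Or.inl ?_⟩
      have h0 : J.map (AddMonoidHom.mulLeft (0 : R)) = ⊥ := by
        rw [eq_bot_iff]
        rintro _ ⟨y, -, rfl⟩
        simp
      rw [key 0, h0, sup_bot_eq]
      exact hg
    · have h2 := h.resolve_left hg
      push Not at hg
      obtain ⟨x, hx, hlt⟩ := hg
      refine ⟨Fin.snoc z x, memJ x hx, Or.inr ?_⟩
      rw [key x]
      calc 2 ^ (t * (m + 1)) = 2 ^ t * 2 ^ (t * m) := by ring
        _ ≤ 2 ^ t * _ := Nat.mul_le_mul_left _ h2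
        _ ≤ _ := hlt.le


theorem rc_field_gen (F : Type*) [Field F] [Finite F] :
    ∃ γ : F, ∀ r : F, r ≠ 0 → ∃ k : ℕ, r = γ ^ k := by
  obtain ⟨γ, hγ⟩ := IsCyclic.exists_monoid_generator (α := Fˣ)
  refine ⟨γ, fun r hr => ?_⟩
  obtain ⟨k, hk⟩ := hγ (Units.mk0 r hr)
  refine ⟨k, ?_⟩
  have := congrArg Units.val hk
  simpa using this.symm

theorem rc_ring_gen {R : Type*} [CommRing R] [Finite R] (n k : ℕ)
    (hn : Nat.card R < 2 ^ (n + 1)) (hk : n ≤ 2 ^ k) :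
    ∃ g : Fin (k + 1) → R, ∀ S : Subring R, (∀ l, g l ∈ S) →
      ∀ r : R, ∃ s ∈ S, r - s ∈ nilradical R := by
  classical
  have hfin : Finite (MaximalSpectrum R) := inferInstance
  have := Fintype.ofFinite (MaximalSpectrum R)
  have hfq : ∀ I : Ideal R, Finite (R ⧸ I) :=
    fun I => Finite.of_surjective _ Ideal.Quotient.mk_surjective
  have hcop : Pairwise (Function.onFun IsCoprime fun I : MaximalSpectrum R => I.asIdeal) :=
    fun I _ h => I.isCoprime_of_ne h
  have crt := fun x : MaximalSpectrum R → R => Ideal.exists_forall_sub_mem_ideal hcop x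
  have hcard : Fintype.card (MaximalSpectrum R) ≤ n := by
    have hsurj : Function.Surjective
        (fun r : R => fun I : MaximalSpectrum R => (Ideal.Quotient.mk I.asIdeal r)) := by
      intro x
      obtain ⟨r, hr⟩ := Ideal.pi_quotient_surjective hcop x
      exact ⟨r, funext hr⟩
    have h1 := Nat.card_le_card_of_surjective _ hsurj
    rw [Nat.card_pi] at h1
    have h2 : 2 ^ Fintype.card (MaximalSpectrum R) ≤
        ∏ I : MaximalSpectrum R, Nat.card (R ⧸ I.asIdeal) := by
      rw [← Finset.card_univ]
      apply Finset.pow_card_le_prod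
      intro I _
      have : Nontrivial (R ⧸ I.asIdeal) := Ideal.Quotient.nontrivial_iff.2 I.isMaximal.ne_top
      have := Finite.one_lt_card (α := R ⧸ I.asIdeal)
      omega
    have h3 := lt_of_le_of_lt (h2.trans h1) hn
    exact Nat.lt_succ_iff.1 ((Nat.pow_lt_pow_iff_right (by norm_num)).1 h3)
  obtain ⟨b⟩ : Nonempty (MaximalSpectrum R ↪ (Fin k → Bool)) := by
    apply Function.Embedding.nonempty_of_card_le
    simp
    omega
  have hγ : ∀ I : MaximalSpectrum R, ∃ γ : R, ∀ r : R, r ∉ I.asIdeal →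
      ∃ k : ℕ, r - γ ^ k ∈ I.asIdeal := by
    intro I
    have := I.isMaximal
    let _ := Ideal.Quotient.field I.asIdeal
    obtain ⟨γ, h⟩ := rc_field_gen (R ⧸ I.asIdeal)
    obtain ⟨γ, rfl⟩ := Ideal.Quotient.mk_surjective γ
    refine ⟨γ, fun r hr => ?_⟩
    obtain ⟨k, hk⟩ := h (Ideal.Quotient.mk _ r) (by
      rwa [Ne, Ideal.Quotient.eq_zero_iff_mem])
    refine ⟨k, ?_⟩
    rw [← map_pow] at hk
    exact Ideal.Quotient.eq.1 hk
  choose γ hγ using hγ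
  obtain ⟨g0, hg0⟩ := crt γ
  choose e he using fun i : Fin k => crt (fun I => if b I i then 1 else 0)
  refine ⟨Fin.cons g0 e, fun S hS r => ?_⟩
  have hg0S : g0 ∈ S := by simpa using hS 0
  have heS : ∀ i, e i ∈ S := fun i => by simpa using hS i.succ
  -- idempotent-like elements
  let ε : MaximalSpectrum R → R := fun I => ∏ i, if b I i then e i else 1 - e i
  have hεS : ∀ I, ε I ∈ S := by
    intro I
    apply Subring.prod_mem
    intro i _
    split_ifs
    · exact heS i
    · exact S.sub_mem S.one_mem (heS i)
  have hek : ∀ (I : MaximalSpectrum R) i,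
      Ideal.Quotient.mk I.asIdeal (e i) = if b I i then 1 else 0 := by
    intro I i
    have := Ideal.Quotient.eq.2 (he i I)
    rw [this]; split_ifs <;> simp
  have hε1 : ∀ I : MaximalSpectrum R, Ideal.Quotient.mk I.asIdeal (ε I) = 1 := by
    intro I
    simp only [ε, map_prod]
    apply Finset.prod_eq_one
    intro i _
    by_cases h : b I i <;> simp [h, hek]
  have hε0 : ∀ I I' : MaximalSpectrum R, I ≠ I' → Ideal.Quotient.mk I.asIdeal (ε I') = 0 := by
    intro I I' hne
    have : b I ≠ b I' := fun h => hne (b.injective h)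
    obtain ⟨i, hi⟩ := Function.ne_iff.1 this
    simp only [ε, map_prod]
    apply Finset.prod_eq_zero (Finset.mem_univ i)
    by_cases h : b I i <;> by_cases h' : b I' i <;> simp [h, h', hek] at hi ⊢
  have hloc : ∀ I : MaximalSpectrum R, ∃ s ∈ S, r - s ∈ I.asIdeal := by
    intro I
    by_cases hr : r ∈ I.asIdeal
    · exact ⟨0, S.zero_mem, by simpa using hr⟩
    · obtain ⟨j, hj⟩ := hγ I r hr
      refine ⟨g0 ^ j, S.pow_mem hg0S j, ?_⟩
      rw [← Ideal.Quotient.eq] at hj ⊢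
      rw [hj, map_pow, map_pow, Ideal.Quotient.eq.2 (hg0 I)]
  choose σ hσS hσ using hloc
  refine ⟨∑ I, ε I * σ I, S.sum_mem fun I _ => S.mul_mem (hεS I) (hσS I), ?_⟩
  rw [IsArtinianRing.nilradical_eq_iInf, Ideal.mem_iInf]
  intro I
  rw [← Ideal.Quotient.eq, map_sum, Finset.sum_eq_single I]
  · rw [map_mul, hε1, one_mul]
    exact Ideal.Quotient.eq.2 (hσ I)
  · intro I' _ hne
    rw [map_mul, hε0 I I' (Ne.symm hne), zero_mul]
  · simp


/-- small data -/
abbrev RCData (A : Type*) (n s k a : ℕ) : Type _ :=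
  A × (Fin n → A) × (Fin a → A) × (Fin a → Fin s → A) × (Fin s → A) × (Fin k → A) ×
    (Fin s → Fin n → A) × (Fin k → Fin n → A)

/-- the small ideal -/
def rcI {A : Type*} [AddCommGroup A] {n : ℕ} (i : Fin n → A) : AddSubgroup A :=
  AddSubgroup.closure (Set.range i)

/-- compatibility of a multiplication with the data -/
structure RCCompat {A : Type*} [AddCommGroup A] {n s k a : ℕ} (N : ℕ) (e : Fin n → A)
    (o : A) (i : Fin n → A) (x : Fin a → A) (w : Fin a → Fin s → A) (z : Fin s → A)
    (g : Fin k → A) (mz : Fin s → Fin n → A) (mg : Fin k → Fin n → A) (μ : A →+ A →+ A) :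
    Prop where
  one : ∀ u, μ o u = u
  hz : ∀ l j, μ (z l) (e j) = mz l j
  hg : ∀ l j, μ (g l) (e j) = mg l j
  hI : rcI i ≤ ⨆ l, (rcI i ⊔ rcI x).map (μ (z l))
  hP : ∀ p q, μ (x p) (x q) ∈ rcI i ⊔ rcI (w p)
  nil : ∀ E : AddSubgroup A, E ≤ ⨆ l, E.map (μ (z l)) → E = ⊥
  gen : ∀ S : AddSubgroup A, o ∈ S → (∀ l, g l ∈ S) → (∀ u ∈ S, ∀ v ∈ S, μ u v ∈ S) →
    S ⊔ (rcI i ⊔ rcI x) = ⊤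
  card1 : 2 ^ a * Nat.card (rcI i) ≤ N
  card2 : ∀ p, Nat.card (rcI i ⊔ rcI (w p) : AddSubgroup A) ≤ 2 ^ s * Nat.card (rcI i)

theorem rc_unique {A : Type*} [AddCommGroup A] {n s k a : ℕ} {N : ℕ} {e : Fin n → A}
    (he : AddSubgroup.closure (Set.range e) = ⊤)
    {o : A} {i : Fin n → A} {x : Fin a → A} {w : Fin a → Fin s → A} {z : Fin s → A}
    {g : Fin k → A} {mz : Fin s → Fin n → A} {mg : Fin k → Fin n → A} {μ ν : A →+ A →+ A}
    (hμ : IsRingMul μ) (hν : IsRingMul ν)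
    (cμ : RCCompat N e o i x w z g mz mg μ) (cν : RCCompat N e o i x w z g mz mg ν)
    (h : ∀ p q, q ≤ p → μ (x p) (x q) = ν (x p) (x q)) : μ = ν := by
  have hxx : ∀ p q, μ (x p) (x q) = ν (x p) (x q) := by
    intro p q
    rcases le_total p q with h1 | h1
    · rw [hμ.comm, hν.comm, h q p h1]
    · exact h p q h1
  have hzz : ∀ l, μ (z l) = ν (z l) := fun l =>
    AddMonoidHom.eq_of_eqOn_dense he (by
      rintro _ ⟨j, rfl⟩
      rw [cμ.hz, cν.hz])
  have hgg : ∀ l, μ (g l) = ν (g l) := fun l =>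
    AddMonoidHom.eq_of_eqOn_dense he (by
      rintro _ ⟨j, rfl⟩
      rw [cμ.hg, cν.hg])
  set J := rcI i ⊔ rcI x with hJ
  let D : A →+ A →+ A := μ - ν
  have hD : ∀ u v, D u v = μ u v - ν u v := fun u v => rfl
  have hDc : ∀ u v, D u v = D v u := by
    intro u v
    rw [hD, hD, hμ.comm, hν.comm]
  have hDz : ∀ l u v, D (μ (z l) u) v = μ (z l) (D u v) := by
    intro l u v
    rw [hD, hD, map_sub, hμ.assoc]
    conv_lhs => rw [hzz l]
    rw [hν.assoc, hzz l]
  let E : AddSubgroup A := AddSubgroup.closure {y | ∃ u ∈ J, ∃ v ∈ J, y = D u v}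
  let F : AddSubgroup A := ⨆ l, E.map (μ (z l))
  have hEF : ∀ l u v, u ∈ J → v ∈ J → D (μ (z l) u) v ∈ F := by
    intro l u v hu hv
    rw [hDz]
    apply AddSubgroup.mem_iSup_of_mem l
    exact ⟨_, AddSubgroup.subset_closure ⟨u, hu, v, hv, rfl⟩, rfl⟩
  -- elements of I
  have hI1 : ∀ v ∈ J, rcI i ≤ F.comap (D.flip v) := by
    intro v hv
    refine cμ.hI.trans (iSup_le fun l => ?_)
    rintro _ ⟨u, hu, rfl⟩
    exact hEF l u v hu hv
  have hx1 : ∀ p, ∀ v ∈ J, D (x p) v ∈ F := by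
    intro p v hv
    have : J ≤ F.comap (D.flip (x p)) := by
      refine sup_le (hI1 _ ?_) ?_
      · exact (le_sup_right : rcI x ≤ J) (AddSubgroup.subset_closure ⟨p, rfl⟩)
      · rw [rcI, AddSubgroup.closure_le]
        rintro _ ⟨q, rfl⟩
        change D (x q) (x p) ∈ F
        rw [hD, hxx, sub_self]
        exact F.zero_mem
    have := this hv
    rw [hDc]
    exact this
  have hJ1 : ∀ u ∈ J, ∀ v ∈ J, D u v ∈ F := by
    intro u hu v hv
    have : J ≤ F.comap (D.flip v) := by
      refine sup_le (hI1 _ hv) ?_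
      rw [rcI, AddSubgroup.closure_le]
      rintro _ ⟨q, rfl⟩
      exact hx1 q v hv
    exact this hu
  have hE0 : E = ⊥ := by
    apply cμ.nil
    rw [AddSubgroup.closure_le]
    rintro _ ⟨u, hu, v, hv, rfl⟩
    exact hJ1 u hu v hv
  have hJJ : ∀ u ∈ J, ∀ v ∈ J, μ u v = ν u v := by
    intro u hu v hv
    have : D u v ∈ E := AddSubgroup.subset_closure ⟨u, hu, v, hv, rfl⟩
    rw [hE0, AddSubgroup.mem_bot, hD] at this
    exact sub_eq_zero.1 this
  let S : AddSubgroup A := D.ker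
  have hS : ∀ u, u ∈ S ↔ μ u = ν u := fun u => by
    change (μ - ν) u = 0 ↔ _
    rw [AddMonoidHom.sub_apply, sub_eq_zero]
  have hgen : S ⊔ J = ⊤ := by
    apply cμ.gen
    · rw [hS]
      ext u
      rw [cμ.one, cν.one]
    · intro l
      rw [hS, hgg]
    · intro u hu v hv
      rw [hS] at hu hv ⊢
      ext y
      rw [hμ.assoc, hu, hv, hν.assoc]
  have hJS : J ≤ S := by
    intro u hu
    rw [hS]
    ext y
    have hy : y ∈ S ⊔ J := by rw [hgen]; trivial
    obtain ⟨y1, hy1, y2, hy2, rfl⟩ := AddSubgroup.mem_sup.1 hy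
    rw [map_add, map_add, hJJ u hu y2 hy2, hμ.comm u y1, hν.comm u y1, (hS _).1 hy1]
  have hST : S = ⊤ := by rw [← hgen]; exact (sup_eq_left.2 hJS).symm
  ext u v
  have hu : u ∈ S := by rw [hST]; trivial
  rw [(hS _).1 hu]

theorem rc_exists {R : Type*} [CommRing R] [Finite R] (N n s k : ℕ) (hN : Nat.card R ≤ N)
    (hn : N < 2 ^ (n + 1)) (hs : n + 1 ≤ s * s) (hk : n ≤ 2 ^ k) (e : Fin n → R) :
    ∃ a ≤ n, ∃ (o : R) (i : Fin n → R) (x : Fin a → R) (w : Fin a → Fin s → R) (z : Fin s → R)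
      (g : Fin (k + 1) → R) (mz : Fin s → Fin n → R) (mg : Fin (k + 1) → Fin n → R),
      RCCompat N e o i x w z g mz mg (AddMonoidHom.mul : R →+ R →+ R) := by
  have hR : Nat.card R < 2 ^ (n + 1) := by omega
  set J : AddSubgroup R := (nilradical R).toAddSubgroup with hJ
  have memJ : ∀ u, u ∈ J ↔ u ∈ nilradical R := fun u => Iff.rfl
  obtain ⟨z, hzJ, hz⟩ := rc_greedy J s s
  set I : AddSubgroup R := ⨆ l, J.map (AddMonoidHom.mulLeft (z l)) with hI
  have hgood := hz.resolve_right (by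
    intro hcon
    have h1 := AddSubgroup.card_le_card_addGroup I
    have h2 : 2 ^ (n + 1) ≤ 2 ^ (s * s) := Nat.pow_le_pow_right (by norm_num) hs
    omega)
  have hIJ : I ≤ J := by
    refine iSup_le fun l => ?_
    rintro _ ⟨u, hu, rfl⟩
    exact Ideal.mul_mem_left _ _ hu
  obtain ⟨i, hi⟩ := rc_gen_bot I n hR
  obtain ⟨a, x, hx, hxc⟩ := rc_gen J I hIJ
  have hJc := AddSubgroup.card_le_card_addGroup J
  have hxJ : ∀ p, x p ∈ J := fun p => by
    rw [hx]
    exact (le_sup_right : _ ≤ I ⊔ _) (AddSubgroup.subset_closure ⟨p, rfl⟩)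
  have hIpos : 0 < Nat.card I := Nat.card_pos
  have ha : a ≤ n := by
    have : 2 ^ a < 2 ^ (n + 1) := by
      have := Nat.le_mul_of_pos_right (2 ^ a) hIpos
      omega
    exact Nat.lt_succ_iff.1 ((Nat.pow_lt_pow_iff_right (by norm_num)).1 this)
  have hw : ∀ p, ∃ w : Fin s → R, I ⊔ J.map (AddMonoidHom.mulLeft (x p)) =
      I ⊔ AddSubgroup.closure (Set.range w) := by
    intro p
    apply rc_gen_pad _ _ le_sup_left
    refine lt_of_le_of_lt (hgood (x p) (hxJ p)) ?_
    have : 2 ^ s < 2 ^ (s + 1) := Nat.pow_lt_pow_right (by norm_num) (by omega)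
    nlinarith
  choose w hw using hw
  obtain ⟨g, hg⟩ := rc_ring_gen n k hR hk
  have hi' : rcI i = I := hi
  have hJ' : rcI i ⊔ rcI x = J := by rw [hi', hx]; rfl
  refine ⟨a, ha, 1, i, x, w, z, g, fun l j => z l * e j, fun l j => g l * e j, ?_⟩
  refine ⟨fun u => by simp, fun l j => by simp, fun l j => by simp, ?_, ?_, ?_, ?_, ?_, ?_⟩
  · rw [hJ', hi']; exact le_rfl
  · intro p q
    rw [hi']
    change _ ∈ I ⊔ AddSubgroup.closure (Set.range (w p))
    rw [← hw p]
    exact (le_sup_right : _ ≤ I ⊔ _) ⟨x q, hxJ q, rfl⟩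
  · intro E hE
    obtain ⟨m, hm⟩ := IsArtinianRing.isNilpotent_nilradical (R := R)
    have key : ∀ m, E ≤ ((nilradical R) ^ m).toAddSubgroup := by
      intro m
      induction m with
      | zero => intro u _; simp
      | succ m ih =>
        refine hE.trans (iSup_le fun l => ?_)
        rintro _ ⟨u, hu, rfl⟩
        change z l * u ∈ nilradical R ^ (m + 1)
        rw [pow_succ']
        exact Ideal.mul_mem_mul (hzJ l) (ih hu)
    rw [eq_bot_iff]
    intro u hu
    have := key m hu
    rw [hm] at this
    simpa using this
  · intro S h1 hgS hmul
    rw [hJ', eq_top_iff]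
    intro r _
    let S' : Subring R :=
      { S with
        mul_mem' := fun {u v} hu hv => hmul u hu v hv
        one_mem' := h1 }
    obtain ⟨u, hu, hru⟩ := hg S' hgS r
    have : r = u + (r - u) := by ring
    rw [this]
    exact AddSubgroup.add_mem_sup hu hru
  · rw [hi']; omega
  · intro p
    rw [hi']
    change Nat.card (I ⊔ AddSubgroup.closure (Set.range (w p)) : AddSubgroup R) ≤ _
    rw [← hw p]
    exact hgood _ (hxJ p)


/-- compatibility with bundled data -/
def RCC {A : Type*} [AddCommGroup A] {n s k a : ℕ} (N : ℕ) (e : Fin n → A)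
    (d : RCData A n s k a) (μ : A →+ A →+ A) : Prop :=
  RCCompat N e d.1 d.2.1 d.2.2.1 d.2.2.2.1 d.2.2.2.2.1 d.2.2.2.2.2.1 d.2.2.2.2.2.2.1
    d.2.2.2.2.2.2.2 μ

theorem rc_exists' {A : Type*} [AddCommGroup A] [Finite A] (N n s k : ℕ) (hN : Nat.card A ≤ N)
    (hn : N < 2 ^ (n + 1)) (hs : n + 1 ≤ s * s) (hk : n ≤ 2 ^ k) (e : Fin n → A)
    (μ : A →+ A →+ A) (h : IsRingMul μ) :
    ∃ d : (Σ a : Fin (n + 1), RCData A n s (k + 1) a), RCC N e d.2 μ := by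
  let _ := h.ring
  obtain ⟨a, ha, o, i, x, w, z, g, mz, mg, H⟩ := rc_exists (R := A) N n s k hN hn hs hk e
  refine ⟨⟨⟨a, Nat.lt_succ_of_le ha⟩, (o, i, x, w, z, g, mz, mg)⟩, ?_⟩
  exact H

theorem rc_tri (a : ℕ) : Fintype.card (Σ p : Fin a, Fin (p.1 + 1)) = a * (a + 1) / 2 := by
  rw [Fintype.card_sigma]
  simp only [Fintype.card_fin]
  rw [Fin.sum_univ_eq_sum_range (fun i => i + 1)]
  have h := Finset.sum_range_id_mul_two (a + 1)
  rw [Finset.sum_range_succ'] at h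
  simp only [add_zero, Nat.add_sub_cancel] at h
  rw [mul_comm a, ← h]
  simp

theorem rc_data_card {A : Type*} [Finite A] (N n s k a : ℕ) (hN : Nat.card A ≤ N) (hN1 : 1 ≤ N)
    (ha : a ≤ n) : Nat.card (RCData A n s k a) ≤
      N ^ (1 + n + n + n * s + s + k + s * n + k * n) := by
  have e1 : Nat.card (RCData A n s k a) =
      Nat.card A ^ (1 + n + a + a * s + s + k + s * n + k * n) := by
    simp only [Nat.card_prod, Nat.card_fun, pow_add, pow_mul, pow_one, Nat.card_eq_fintype_card, Fintype.card_fin]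
    rw [← pow_mul, mul_comm s a, ← pow_mul, ← pow_mul, ← pow_mul, ← pow_mul, ← pow_mul, mul_comm n s, mul_comm n k]
    ring
  rw [e1]
  calc _ ≤ N ^ (1 + n + a + a * s + s + k + s * n + k * n) := Nat.pow_le_pow_left hN _
    _ ≤ _ := Nat.pow_le_pow_right hN1 (by gcongr)

theorem rc_fiber {A : Type*} [AddCommGroup A] [Finite A] (N n s k a B : ℕ) (e : Fin n → A)
    (he : AddSubgroup.closure (Set.range e) = ⊤)
    (hB : ∀ c, 1 ≤ c → 2 ^ a * c ≤ N → (2 ^ s * c) ^ (a * (a + 1) / 2) ≤ B)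
    (d : RCData A n s k a) :
    Nat.card {μ : A →+ A →+ A // IsRingMul μ ∧ RCC N e d μ} ≤ B := by
  by_cases hem : IsEmpty {μ : A →+ A →+ A // IsRingMul μ ∧ RCC N e d μ}
  · simp
  rw [not_isEmpty_iff] at hem
  obtain ⟨⟨μ0, hμ0, c0⟩⟩ := hem
  let P : Fin a → AddSubgroup A := fun p => rcI d.2.1 ⊔ rcI (d.2.2.2.1 p)
  let f : {μ : A →+ A →+ A // IsRingMul μ ∧ RCC N e d μ} →
      (∀ v : (Σ p : Fin a, Fin (p.1 + 1)), P v.1) := fun μ v =>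
    ⟨μ.1 (d.2.2.1 v.1) (d.2.2.1 ⟨v.2.1, by have := v.2.2; have := v.1.2; omega⟩), μ.2.2.hP _ _⟩
  have hf : Function.Injective f := by
    rintro ⟨μ, hμ, cμ⟩ ⟨ν, hν, cν⟩ h
    apply Subtype.ext
    apply rc_unique he hμ hν cμ cν
    intro p q hqp
    have := congrFun h ⟨p, ⟨q.1, Nat.lt_succ_of_le hqp⟩⟩
    exact congrArg Subtype.val this
  refine (Nat.card_le_card_of_injective f hf).trans ?_
  rw [Nat.card_pi]
  refine le_trans ?_ (hB (Nat.card (rcI d.2.1)) Nat.card_pos c0.card1)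
  rw [← rc_tri, ← Finset.card_univ]
  apply Finset.prod_le_pow_card
  intro v _
  exact c0.card2 v.1

theorem rc_count {A : Type*} [AddCommGroup A] [Finite A] (N n s k B : ℕ) (hN : Nat.card A ≤ N)
    (hn : N < 2 ^ (n + 1)) (hs : n + 1 ≤ s * s) (hk : n ≤ 2 ^ k)
    (hB : ∀ a ≤ n, ∀ c, 1 ≤ c → 2 ^ a * c ≤ N → (2 ^ s * c) ^ (a * (a + 1) / 2) ≤ B) :
    Nat.card {μ : A →+ A →+ A // IsRingMul μ} ≤
      B * ((n + 1) * N ^ (1 + n + n + n * s + s + (k + 1) + s * n + (k + 1) * n)) := by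
  classical
  have hpos : 0 < Nat.card A := Nat.card_pos
  obtain ⟨e, he⟩ := rc_gen_bot (⊤ : AddSubgroup A) n (by omega)
  have hfin : Finite (A →+ A →+ A) := by
    have h1 : Finite (A →+ A) := Finite.of_injective _ (DFunLike.coe_injective (F := A →+ A))
    exact Finite.of_injective _ (DFunLike.coe_injective (F := A →+ A →+ A))
  have := Fintype.ofFinite {μ : A →+ A →+ A // IsRingMul μ}
  have := Fintype.ofFinite A
  choose key hkey using fun μ : {μ : A →+ A →+ A // IsRingMul μ} =>
    rc_exists' N n s k hN hn hs hk e μ.1 μ.2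
  rw [Nat.card_eq_fintype_card, ← Finset.card_univ]
  refine (Finset.card_le_mul_card_image (f := key) _ B ?_).trans ?_
  · intro d _
    refine le_trans ?_ (rc_fiber N n s (k + 1) d.1 B e he
      (hB d.1 (Nat.lt_succ_iff.1 d.1.2)) d.2)
    rw [← Fintype.card_coe, ← Nat.card_eq_fintype_card]
    refine Nat.card_le_card_of_injective (fun μ => ⟨μ.1.1, μ.1.2, ?_⟩) ?_
    · have h1 := (Finset.mem_filter.1 μ.2).2
      have h2 := hkey μ.1
      rw [h1] at h2
      exact h2
    · intro μ ν h
      apply Subtype.ext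
      apply Subtype.ext
      have h5 := congrArg Subtype.val h
      exact h5
  · apply Nat.mul_le_mul_left
    refine (Finset.card_le_univ _).trans ?_
    rw [Fintype.card_sigma]
    have h3 : ∀ a ∈ (Finset.univ : Finset (Fin (n + 1))), Fintype.card (RCData A n s (k + 1) a) ≤
        N ^ (1 + n + n + n * s + s + (k + 1) + s * n + (k + 1) * n) := by
      intro a _
      rw [← Nat.card_eq_fintype_card]
      exact rc_data_card N n s (k + 1) a hN (by omega) (Nat.lt_succ_iff.1 a.2)
    refine (Finset.sum_le_card_nsmul _ _ _ h3).trans ?_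
    simp

/-- model additive groups -/
abbrev RCA {N n : ℕ} (κ : Σ m : Fin (n + 1), (Fin m → Fin (N + 1))) : Type :=
  ∀ i : Fin κ.1, ZMod (κ.2 i : ℕ)

theorem rc_model {R : Type} [AddCommGroup R] [Finite R] (N n : ℕ) (hN : Nat.card R ≤ N)
    (hn : N < 2 ^ (n + 1)) :
    ∃ κ : (Σ m : Fin (n + 1), (Fin m → Fin (N + 1))), Nonempty (R ≃+ RCA κ) := by
  classical
  obtain ⟨ι, _, p, hp, ⟨φ⟩⟩ := AddCommGroup.equiv_directSum_zmod_of_finite' R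
  let ψ : R ≃+ (∀ i, ZMod (p i)) := φ.trans (DirectSum.addEquivProd _)
  let ε := Fintype.equivFin ι
  let χ : (∀ i, ZMod (p i)) ≃+ (∀ j : Fin (Fintype.card ι), ZMod (p (ε.symm j))) :=
    { Equiv.piCongrLeft' _ ε with map_add' := fun _ _ => rfl }
  have hcard : Nat.card R = ∏ i, p i := by
    rw [Nat.card_congr ψ.toEquiv, Nat.card_pi]
    simp
  have hpos : 0 < Nat.card R := Nat.card_pos
  have h1 : 2 ^ Fintype.card ι ≤ ∏ i, p i := by
    rw [← Finset.card_univ]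
    exact Finset.pow_card_le_prod _ _ _ (fun i _ => hp i)
  have hm : Fintype.card ι < n + 1 := by
    apply (Nat.pow_lt_pow_iff_right (a := 2) (by norm_num)).1
    omega
  have hle : ∀ i, p i ≤ N := by
    intro i
    have : p i ∣ Nat.card R := by rw [hcard]; exact Finset.dvd_prod_of_mem _ (Finset.mem_univ i)
    exact (Nat.le_of_dvd hpos this).trans hN
  exact ⟨⟨⟨Fintype.card ι, hm⟩, fun j => ⟨p (ε.symm j), Nat.lt_succ_of_le (hle _)⟩⟩,
    ⟨ψ.trans χ⟩⟩

/-- transport of the multiplication -/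
noncomputable def rcMul {R A : Type} [CommRing R] [AddCommGroup A] (φ : R ≃+ A) : A →+ A →+ A :=
  AddMonoidHom.mk' (fun x => AddMonoidHom.mk' (fun y => φ (φ.symm x * φ.symm y))
    (fun y z => by simp [mul_add])) (fun x y => by ext z; simp [add_mul])

theorem rcMul_apply {R A : Type} [CommRing R] [AddCommGroup A] (φ : R ≃+ A) (x y : A) :
    rcMul φ x y = φ (φ.symm x * φ.symm y) := rfl

theorem rcMul_isRingMul {R A : Type} [CommRing R] [AddCommGroup A] (φ : R ≃+ A) :
    IsRingMul (rcMul φ) where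
  comm x y := by simp [rcMul_apply, mul_comm]
  assoc x y z := by simp [rcMul_apply, mul_assoc]
  one := ⟨φ 1, fun x => by simp [rcMul_apply]⟩

/-- the target of the encoding -/
abbrev RCTarget (N n : ℕ) : Type :=
  Σ κ : (Σ m : Fin (n + 1), (Fin m → Fin (N + 1))),
    {μ : RCA κ →+ RCA κ →+ RCA κ // IsRingMul μ ∧ Finite (RCA κ) ∧ Nat.card (RCA κ) ≤ N}

theorem rc_iso {R R' A : Type} [CommRing R] [CommRing R'] [AddCommGroup A] (φ1 : R ≃+ A)
    (φ2 : R' ≃+ A) (h2 : rcMul φ1 = rcMul φ2) : Nonempty (R ≃+* R') := by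
  refine ⟨{ φ1.trans φ2.symm with map_mul' := fun x y => ?_ }⟩
  have := DFunLike.congr_fun (DFunLike.congr_fun h2 (φ1 x)) (φ1 y)
  rw [rcMul_apply, rcMul_apply] at this
  simp only [AddEquiv.symm_apply_apply] at this
  change φ2.symm (φ1 (x * y)) = φ2.symm (φ1 x) * φ2.symm (φ1 y)
  rw [this, AddEquiv.symm_apply_apply]

theorem rc_iso' {R R' : Type} [CommRing R] [CommRing R'] {N n : ℕ} (t t' : RCTarget N n)
    (φ1 : R ≃+ RCA t.1) (φ2 : R' ≃+ RCA t'.1) (h1 : t.2.1 = rcMul φ1) (h2 : t'.2.1 = rcMul φ2)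
    (h : t = t') : Nonempty (R ≃+* R') := by
  subst h
  exact rc_iso φ1 φ2 (h1.symm.trans h2)

theorem rc_encode_one (N n : ℕ) (hn : N < 2 ^ (n + 1)) (Q : FinCommRingLE N) :
    ∃ t : RCTarget N n, ∃ φ : Q.carrier ≃+ RCA t.1, t.2.1 = rcMul φ := by
  have hfin : Finite Q.carrier := (Nat.card_pos_iff.1 Q.card_pos).2
  obtain ⟨κ, ⟨φ⟩⟩ := rc_model (R := Q.carrier) N n Q.card_le hn
  have hc : Nat.card (RCA κ) ≤ N := by
    rw [← Nat.card_congr φ.toEquiv]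
    exact Q.card_le
  exact ⟨⟨κ, rcMul φ, rcMul_isRingMul φ, Finite.of_equiv _ φ.toEquiv, hc⟩, φ, rfl⟩

theorem rc_encode (N n : ℕ) (hn : N < 2 ^ (n + 1)) :
    ∃ f : Quot (FinCommRingLE.Iso (N := N)) → RCTarget N n, Function.Injective f := by
  choose f φ hf using rc_encode_one N n hn
  refine ⟨fun q => f q.out, fun q q' hqq => ?_⟩
  rw [← Quot.out_eq q, ← Quot.out_eq q']
  apply Quot.sound
  exact rc_iso' _ _ (φ q.out) (φ q'.out) (hf _) (hf _) hqq

theorem rc_upper (N n s k B : ℕ)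
    (hn : N < 2 ^ (n + 1)) (hs : n + 1 ≤ s * s) (hk : n ≤ 2 ^ k)
    (hB : ∀ a ≤ n, ∀ c, 1 ≤ c → 2 ^ a * c ≤ N → (2 ^ s * c) ^ (a * (a + 1) / 2) ≤ B) :
    Finite (Quot (FinCommRingLE.Iso (N := N))) ∧
    ringCountLE N ≤ ((n + 1) * (N + 1) ^ n) *
      (B * ((n + 1) * N ^ (1 + n + n + n * s + s + (k + 1) + s * n + (k + 1) * n))) := by
  obtain ⟨f, hf⟩ := rc_encode N n hn
  have hfin0 : ∀ κ : (Σ m : Fin (n + 1), (Fin m → Fin (N + 1))),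
      Finite {μ : RCA κ →+ RCA κ →+ RCA κ //
        IsRingMul μ ∧ Finite (RCA κ) ∧ Nat.card (RCA κ) ≤ N} := by
    intro κ
    by_cases hA : Finite (RCA κ)
    · have hfin : Finite (RCA κ →+ RCA κ →+ RCA κ) := by
        have h1 : Finite (RCA κ →+ RCA κ) :=
          Finite.of_injective _ (DFunLike.coe_injective (F := RCA κ →+ RCA κ))
        exact Finite.of_injective _ (DFunLike.coe_injective (F := RCA κ →+ RCA κ →+ RCA κ))
      infer_instance
    · have : IsEmpty {μ : RCA κ →+ RCA κ →+ RCA κ //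
        IsRingMul μ ∧ Finite (RCA κ) ∧ Nat.card (RCA κ) ≤ N} := ⟨fun μ => hA μ.2.2.1⟩
      infer_instance
  have hT : Finite (RCTarget N n) := inferInstance
  refine ⟨Finite.of_injective f hf, ?_⟩
  refine (Nat.card_le_card_of_injective f hf).trans ?_
  rw [Nat.card_sigma]
  have h3 : ∀ κ ∈ (Finset.univ : Finset (Σ m : Fin (n + 1), (Fin m → Fin (N + 1)))),
      Nat.card {μ : RCA κ →+ RCA κ →+ RCA κ //
        IsRingMul μ ∧ Finite (RCA κ) ∧ Nat.card (RCA κ) ≤ N} ≤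
      (B * ((n + 1) * N ^ (1 + n + n + n * s + s + (k + 1) + s * n + (k + 1) * n))) := by
    intro κ _
    by_cases hA : Finite (RCA κ) ∧ Nat.card (RCA κ) ≤ N
    · have := hA.1
      refine le_trans ?_ (rc_count (A := RCA κ) N n s k B hA.2 hn hs hk hB)
      have hfin : Finite (RCA κ →+ RCA κ →+ RCA κ) := by
        have h1 : Finite (RCA κ →+ RCA κ) :=
          Finite.of_injective _ (DFunLike.coe_injective (F := RCA κ →+ RCA κ))
        exact Finite.of_injective _ (DFunLike.coe_injective (F := RCA κ →+ RCA κ →+ RCA κ))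
      apply Nat.card_le_card_of_injective
        (fun μ : {μ : RCA κ →+ RCA κ →+ RCA κ //
          IsRingMul μ ∧ Finite (RCA κ) ∧ Nat.card (RCA κ) ≤ N} =>
          (⟨μ.1, μ.2.1⟩ : {μ : RCA κ →+ RCA κ →+ RCA κ // IsRingMul μ}))
      intro μ ν h
      have h5 := congrArg Subtype.val h
      exact Subtype.ext h5
    · have : IsEmpty {μ : RCA κ →+ RCA κ →+ RCA κ //
        IsRingMul μ ∧ Finite (RCA κ) ∧ Nat.card (RCA κ) ≤ N} := ⟨fun μ => hA μ.2.2⟩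
      simp
  refine (Finset.sum_le_card_nsmul _ _ _ h3).trans ?_
  rw [smul_eq_mul]
  apply Nat.mul_le_mul_right
  rw [Finset.card_univ, Fintype.card_sigma]
  have h4 : ∀ m ∈ (Finset.univ : Finset (Fin (n + 1))),
      Fintype.card (Fin m → Fin (N + 1)) ≤ (N + 1) ^ n := by
    intro m _
    simp only [Fintype.card_fun, Fintype.card_fin]
    exact Nat.pow_le_pow_right (by omega) (Nat.lt_succ_iff.1 m.2)
  refine (Finset.sum_le_card_nsmul _ _ _ h4).trans ?_
  simp

/-- the additive group of the lower bound rings -/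
abbrev RCL (d r : ℕ) : Type := ZMod 2 × (Fin d → ZMod 2) × (Fin r → ZMod 2)

/-- the bilinear map with prescribed values -/
noncomputable def rcBil {d r : ℕ} (c : Sym2 (Fin d) → (Fin r → ZMod 2)) :
    (Fin d → ZMod 2) →ₗ[ZMod 2] (Fin d → ZMod 2) →ₗ[ZMod 2] (Fin r → ZMod 2) :=
  LinearMap.mk₂ (ZMod 2) (fun v v' => ∑ i, ∑ j, (v i * v' j) • c s(i, j))
    (fun v v' u => by simp [add_mul, add_smul, Finset.sum_add_distrib])
    (fun a v u => by simp [mul_smul, Finset.smul_sum])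
    (fun v u u' => by simp [mul_add, add_smul, Finset.sum_add_distrib])
    (fun a v u => by simp [mul_smul, Finset.smul_sum, smul_comm a])

theorem rcBil_apply {d r : ℕ} (c : Sym2 (Fin d) → (Fin r → ZMod 2)) (v v' : Fin d → ZMod 2) :
    rcBil c v v' = ∑ i, ∑ j, (v i * v' j) • c s(i, j) := rfl

theorem rcBil_comm {d r : ℕ} (c : Sym2 (Fin d) → (Fin r → ZMod 2)) (v v' : Fin d → ZMod 2) :
    rcBil c v v' = rcBil c v' v := by
  rw [rcBil_apply, rcBil_apply, Finset.sum_comm]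
  refine Finset.sum_congr rfl fun i _ => Finset.sum_congr rfl fun j _ => ?_
  rw [Sym2.eq_swap, mul_comm]

theorem rcBil_single {d r : ℕ} (c : Sym2 (Fin d) → (Fin r → ZMod 2)) (i j : Fin d) :
    rcBil c (Pi.single i 1) (Pi.single j 1) = c s(i, j) := by
  rw [rcBil_apply, Finset.sum_eq_single i, Finset.sum_eq_single j]
  · simp
  · intro b _ hb
    simp [hb]
  · simp
  · intro b _ hb
    simp [hb]
  · simp

/-- the multiplication -/
noncomputable def rcLMul {d r : ℕ} (c : Sym2 (Fin d) → (Fin r → ZMod 2)) :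
    RCL d r →+ RCL d r →+ RCL d r :=
  AddMonoidHom.mk' (fun x => AddMonoidHom.mk'
    (fun y => (x.1 * y.1, x.1 • y.2.1 + y.1 • x.2.1,
      x.1 • y.2.2 + y.1 • x.2.2 + rcBil c x.2.1 y.2.1))
    (fun y z => by
      refine Prod.ext ?_ (Prod.ext ?_ ?_)
      · simp [mul_add]
      · simp only [Prod.fst_add, Prod.snd_add]
        module
      · simp only [Prod.fst_add, Prod.snd_add, map_add]
        module))
    (fun x y => by
      refine AddMonoidHom.ext fun z => ?_
      refine Prod.ext ?_ (Prod.ext ?_ ?_)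
      · simp [add_mul]
      · simp only [Prod.fst_add, Prod.snd_add, AddMonoidHom.mk'_apply, AddMonoidHom.add_apply]
        module
      · simp only [Prod.fst_add, Prod.snd_add, map_add, AddMonoidHom.mk'_apply,
          AddMonoidHom.add_apply, LinearMap.add_apply]
        module)

theorem rcLMul_apply {d r : ℕ} (c : Sym2 (Fin d) → (Fin r → ZMod 2)) (x y : RCL d r) :
    rcLMul c x y = (x.1 * y.1, x.1 • y.2.1 + y.1 • x.2.1,
      x.1 • y.2.2 + y.1 • x.2.2 + rcBil c x.2.1 y.2.1) := rfl

theorem rcLMul_isRingMul {d r : ℕ} (c : Sym2 (Fin d) → (Fin r → ZMod 2)) :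
    IsRingMul (rcLMul c) where
  comm x y := by
    rw [rcLMul_apply, rcLMul_apply, mul_comm, add_comm (x.1 • y.2.1), add_comm (x.1 • y.2.2),
      rcBil_comm]
  assoc x y z := by
    simp only [rcLMul_apply]
    refine Prod.ext ?_ (Prod.ext ?_ ?_)
    · simp [mul_assoc]
    · simp only
      module
    · simp only [map_add, map_smul, LinearMap.add_apply, LinearMap.smul_apply]
      module
  one := ⟨(1, 0, 0), fun x => by simp [rcLMul_apply]⟩

theorem rcLMul_inj {d r : ℕ} (c c' : Sym2 (Fin d) → (Fin r → ZMod 2))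
    (h : ∀ x y, rcLMul c x y = rcLMul c' x y) : c = c' := by
  funext q
  induction q using Sym2.ind with
  | _ i j =>
    have := h (0, Pi.single i 1, 0) (0, Pi.single j 1, 0)
    rw [rcLMul_apply, rcLMul_apply] at this
    have h2 := congrArg (fun t => t.2.2) this
    simpa [rcBil_single] using h2

theorem rcL_card (d r : ℕ) : Nat.card (RCL d r) = 2 ^ (1 + d + r) := by
  rw [Nat.card_eq_fintype_card]
  simp only [Fintype.card_prod, Fintype.card_fun, Fintype.card_fin, ZMod.card]
  ring

/-- the bundled ring -/
noncomputable def rcLRing {N d r : ℕ} (hN : 2 ^ (1 + d + r) ≤ N)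
    (c : Sym2 (Fin d) → (Fin r → ZMod 2)) : FinCommRingLE N :=
  { carrier := RCL d r
    commRing := (rcLMul_isRingMul c).ring
    card_pos := by rw [rcL_card]; positivity
    card_le := by rw [rcL_card]; exact hN }

theorem rc_iso_equiv (N : ℕ) : Equivalence (FinCommRingLE.Iso (N := N)) where
  refl _ := ⟨RingEquiv.refl _⟩
  symm := fun ⟨φ⟩ => ⟨φ.symm⟩
  trans := fun ⟨φ⟩ ⟨ψ⟩ => ⟨φ.trans ψ⟩

theorem rc_lower_hom {N d r : ℕ} (hN : 2 ^ (1 + d + r) ≤ N)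
    (c : Sym2 (Fin d) → (Fin r → ZMod 2)) :
    ∃ f : RCL d r →+ (Quot.mk FinCommRingLE.Iso (rcLRing hN c)).out.carrier,
      Function.Injective f ∧ ∀ x y, f (rcLMul c x y) = f x * f y := by
  have h := Quot.out_eq (Quot.mk FinCommRingLE.Iso (rcLRing hN c))
  have h2 := (rc_iso_equiv N).eqvGen_iff.1 (Quot.eqvGen_exact h)
  obtain ⟨φ⟩ := (rc_iso_equiv N).symm h2
  exact ⟨φ.toAddEquiv.toAddMonoidHom, φ.injective, fun x y => φ.map_mul x y⟩

theorem rc_lower_inj {N n d r : ℕ} {e : Fin n → RCL d r}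
    (he : AddSubgroup.closure (Set.range e) = ⊤)
    (c c' : Sym2 (Fin d) → (Fin r → ZMod 2))
    (ι : ∀ q : Quot (FinCommRingLE.Iso (N := N)), q.out.carrier → Fin N)
    (hι : ∀ q, Function.Injective (ι q))
    (q q' : Quot (FinCommRingLE.Iso (N := N)))
    (f : RCL d r →+ q.out.carrier) (f' : RCL d r →+ q'.out.carrier)
    (hf : Function.Injective f) (hm : ∀ x y, f (rcLMul c x y) = f x * f y)
    (hm' : ∀ x y, f' (rcLMul c' x y) = f' x * f' y) (hq : q = q')
    (h : (fun j => ι q (f (e j))) = fun j => ι q' (f' (e j))) : c = c' := by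
  subst hq
  have hff : f = f' := AddMonoidHom.eq_of_eqOn_dense he (by
    rintro _ ⟨j, rfl⟩
    exact hι _ (congrFun h j))
  subst hff
  apply rcLMul_inj
  intro x y
  apply hf
  rw [hm, hm']

theorem rc_lower (N d r : ℕ) (hN : 2 ^ (1 + d + r) ≤ N)
    (hfin : Finite (Quot (FinCommRingLE.Iso (N := N)))) :
    (2 ^ r) ^ ((d + 1).choose 2) ≤ ringCountLE N * N ^ (1 + d + r) := by
  have hA : Finite (RCL d r) := inferInstance
  obtain ⟨e, he⟩ := rc_gen_bot (⊤ : AddSubgroup (RCL d r)) (1 + d + r) (by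
    rw [rcL_card]; exact Nat.pow_lt_pow_right (by norm_num) (by omega))
  have hι : ∀ q : Quot (FinCommRingLE.Iso (N := N)), ∃ ι : q.out.carrier → Fin N,
      Function.Injective ι := by
    intro q
    have : Finite q.out.carrier := (Nat.card_pos_iff.1 q.out.card_pos).2
    have := Fintype.ofFinite q.out.carrier
    have h := q.out.card_le
    rw [Nat.card_eq_fintype_card] at h
    obtain ⟨ι⟩ := Function.Embedding.nonempty_of_card_le (α := q.out.carrier) (β := Fin N)
      (by simpa using h)
    exact ⟨ι, ι.injective⟩
  choose ι hι using hι
  choose f hf hm using rc_lower_hom (N := N) (d := d) (r := r) hN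
  have hinj : Function.Injective (fun c : Sym2 (Fin d) → (Fin r → ZMod 2) =>
      ((Quot.mk FinCommRingLE.Iso (rcLRing hN c), fun j => ι _ (f c (e j))) :
        Quot (FinCommRingLE.Iso (N := N)) × (Fin (1 + d + r) → Fin N))) := by
    intro c c' h
    exact rc_lower_inj he c c' ι hι _ _ (f c) (f c') (hf c) (hm c) (hm c')
      (congrArg Prod.fst h) (congrArg Prod.snd h)
  have := Nat.card_le_card_of_injective _ hinj
  rw [Nat.card_prod] at this
  simp only [Nat.card_eq_fintype_card (α := Sym2 (Fin d) → (Fin r → ZMod 2)),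
    Nat.card_eq_fintype_card (α := Fin (1 + d + r) → Fin N),
    Fintype.card_fun, Fintype.card_fin, ZMod.card, Sym2.card] at this
  exact this

theorem rc_amgm (a b ν : ℝ) (ha : 0 ≤ a) (hb : 0 ≤ b) (h : a + b ≤ ν) :
    a ^ 2 * b / 2 ≤ 2 / 27 * ν ^ 3 := by
  have h1 : (a + b) ^ 3 ≤ ν ^ 3 := pow_le_pow_left₀ (by linarith) h 3
  have h2 : 0 ≤ (a - 2 * b) ^ 2 * (4 * a + b) := by positivity
  nlinarith

theorem rc_tableBound (N n s : ℕ) (ν : ℝ) (hν : Real.log N = Real.log 2 * ν) (hν1 : 1 ≤ ν)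
    (hs1 : 1 ≤ s) (hN : 2 ≤ N)
    (a : ℕ) (c : ℕ) (hc : 1 ≤ c) (h : 2 ^ a * c ≤ N) :
    (2 ^ s * c) ^ (a * (a + 1) / 2) ≤
      ⌊Real.exp (Real.log 2 * (2 / 27 * ν ^ 3 + ν ^ 2 + s * ν ^ 2))⌋₊ := by
  apply Nat.le_floor
  have hl : 0 < Real.log 2 := Real.log_pos (by norm_num)
  have hc0 : (0 : ℝ) < c := by exact_mod_cast hc
  rw [← Real.log_le_iff_le_exp (by positivity)]
  push_cast
  rw [Real.log_pow, Real.log_mul (by positivity) (by positivity), Real.log_pow]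
  obtain ⟨b, hb⟩ : ∃ b, Real.log c = Real.log 2 * b := ⟨Real.log c / Real.log 2, by field_simp⟩
  have hb0 : 0 ≤ b := by
    have : 0 ≤ Real.log c := Real.log_nonneg (by exact_mod_cast hc)
    rw [hb] at this
    exact nonneg_of_mul_nonneg_right this hl
  have hab : (a : ℝ) + b ≤ ν := by
    have h1 : Real.log ((2 : ℝ) ^ a * c) ≤ Real.log N :=
      Real.log_le_log (by positivity) (by exact_mod_cast h)
    rw [Real.log_mul (by positivity) (by positivity), Real.log_pow, hb, hν] at h1
    have : Real.log 2 * (a + b) ≤ Real.log 2 * ν := by linarith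
    exact le_of_mul_le_mul_left this hl
  rw [hb]
  have ha0 : (0 : ℝ) ≤ a := Nat.cast_nonneg a
  have hs0 : (0 : ℝ) ≤ s := Nat.cast_nonneg s
  have hdiv : ((a * (a + 1) / 2 : ℕ) : ℝ) ≤ (a : ℝ) * (a + 1) / 2 := by
    have := @Nat.cast_div_le ℝ _ _ _ (a * (a + 1)) 2
    push_cast at this
    exact this
  have haν : (a : ℝ) ≤ ν := by linarith
  have hbν : b ≤ ν := by linarith
  have h1 := rc_amgm a b ν ha0 hb0 hab
  have h2 : (a : ℝ) * b ≤ ν ^ 2 := by nlinarith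
  have h3 : (a : ℝ) * (a + 1) / 2 ≤ ν ^ 2 := by nlinarith
  calc ((a * (a + 1) / 2 : ℕ) : ℝ) * (s * Real.log 2 + Real.log 2 * b)
      ≤ ((a : ℝ) * (a + 1) / 2) * (s * Real.log 2 + Real.log 2 * b) := by
        apply mul_le_mul_of_nonneg_right hdiv; positivity
    _ = Real.log 2 * ((a : ℝ) ^ 2 * b / 2 + a * b / 2 + s * ((a : ℝ) * (a + 1) / 2)) := by ring
    _ ≤ _ := by
        apply mul_le_mul_of_nonneg_left _ hl.le
        have := mul_le_mul_of_nonneg_left h3 hs0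
        nlinarith [mul_nonneg ha0 hb0]

theorem rc_params (N : ℕ) (hN : 2 ≤ N) : ∃ (n s : ℕ) (ν h : ℝ), 1 ≤ n ∧ 1 ≤ s ∧ 1 ≤ ν ∧
    Real.log N = Real.log 2 * ν ∧ 2 ^ n ≤ N ∧ N < 2 ^ (n + 1) ∧ (n : ℝ) ≤ ν ∧ ν ≤ n + 1 ∧
    n + 1 ≤ s * s ∧ n ≤ 2 ^ (2 * s) ∧ 1 ≤ h ∧ h ^ 2 = ν ∧ (s : ℝ) ≤ 2 * h := by
  have hl : 0 < Real.log 2 := Real.log_pos (by norm_num)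
  have hN0 : (0 : ℝ) < N := by positivity
  have hn1 : 1 ≤ Nat.log 2 N := Nat.log_pos (by norm_num) hN
  have e1 : 2 ^ (Nat.log 2 N) ≤ N := Nat.pow_log_le_self 2 (by omega)
  have e2 : N < 2 ^ (Nat.log 2 N + 1) := Nat.lt_pow_succ_log_self (by norm_num) N
  set n := Nat.log 2 N with hn
  have hnν : (n : ℝ) ≤ Real.log N / Real.log 2 := by
    rw [le_div_iff₀ hl, ← Real.log_pow]
    exact Real.log_le_log (by positivity) (by exact_mod_cast e1)
  have hνn : Real.log N / Real.log 2 ≤ n + 1 := by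
    rw [div_le_iff₀ hl]
    have : ((n : ℝ) + 1) = ((n + 1 : ℕ) : ℝ) := by push_cast; ring
    rw [this, ← Real.log_pow]
    exact Real.log_le_log (by positivity) (by exact_mod_cast e2.le)
  have h1n : (1 : ℝ) ≤ n := by exact_mod_cast hn1
  have hν1 : 1 ≤ Real.log N / Real.log 2 := h1n.trans hnν
  have hh : 1 ≤ Real.sqrt (Real.log N / Real.log 2) := Real.one_le_sqrt.2 hν1
  have hs := Nat.lt_succ_sqrt n
  refine ⟨n, Nat.sqrt n + 1, Real.log N / Real.log 2, Real.sqrt (Real.log N / Real.log 2),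
    hn1, by omega, hν1, by field_simp, e1, e2, hnν, hνn, hs, ?_, hh,
    Real.sq_sqrt (by linarith), ?_⟩
  · have h3 : Nat.sqrt n + 1 < 2 ^ (Nat.sqrt n + 1) := Nat.lt_two_pow_self
    have h4 : 2 ^ (2 * (Nat.sqrt n + 1)) = 2 ^ (Nat.sqrt n + 1) * 2 ^ (Nat.sqrt n + 1) := by
      rw [two_mul, pow_add]
    rw [h4]
    have h5 := Nat.mul_le_mul h3.le h3.le
    have h6 : n < (Nat.sqrt n + 1) * (Nat.sqrt n + 1) := hs
    omega
  · push_cast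
    have : (Nat.sqrt n : ℝ) ≤ Real.sqrt n := Real.nat_sqrt_le_real_sqrt
    have h7 : Real.sqrt n ≤ Real.sqrt (Real.log N / Real.log 2) := Real.sqrt_le_sqrt hnν
    linarith

theorem rc_upper_real (N n s : ℕ) (ν h : ℝ) (hN : 2 ≤ N) (hn1 : 1 ≤ n) (hs1 : 1 ≤ s)
    (hν1 : 1 ≤ ν)
    (hν : Real.log N = Real.log 2 * ν) (e2 : N < 2 ^ (n + 1)) (hnν : (n : ℝ) ≤ ν)
    (hs : n + 1 ≤ s * s) (hk : n ≤ 2 ^ (2 * s)) (hh : 1 ≤ h) (hsq : h ^ 2 = ν)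
    (hsh : (s : ℝ) ≤ 2 * h) (hT : 1 ≤ ringCountLE N) :
    Real.log (ringCountLE N) ≤ Real.log 2 * (2 / 27 * ν ^ 3) + 40 * (h * ν ^ 2) := by
  have hl : 0 < Real.log 2 := Real.log_pos (by norm_num)
  have hl1 : Real.log 2 ≤ 1 := by
    have := Real.log_le_sub_one_of_pos (show (0 : ℝ) < 2 by norm_num)
    linarith
  set X := Real.log 2 * (2 / 27 * ν ^ 3 + ν ^ 2 + s * ν ^ 2) with hX
  have hub := (rc_upper N n s (2 * s) ⌊Real.exp X⌋₊ e2 hs hk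
    (fun a _ c hc h => rc_tableBound N n s ν hν hν1 hs1 hN a c hc h)).2
  set E := 1 + n + n + n * s + s + (2 * s + 1) + s * n + (2 * s + 1) * n with hE
  have hEb : E ≤ 12 * (n * s) := by
    rw [hE]
    have : n ≤ n * s := Nat.le_mul_of_pos_right _ hs1
    have : s ≤ n * s := Nat.le_mul_of_pos_left _ hn1
    have : (2 * s + 1) * n = 2 * (n * s) + n := by ring
    have : s * n = n * s := by ring
    omega
  have hN0 : (0 : ℝ) < N := by positivity
  have hT0 : (0 : ℝ) < ringCountLE N := by exact_mod_cast hT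
  have hub2 : (ringCountLE N : ℝ) ≤
      (((n : ℝ) + 1) * ((N : ℝ) + 1) ^ n) * (Real.exp X * (((n : ℝ) + 1) * (N : ℝ) ^ E)) := by
    have h1 : (ringCountLE N : ℝ) ≤ ((((n + 1) * (N + 1) ^ n) *
      (⌊Real.exp X⌋₊ * ((n + 1) * N ^ E)) : ℕ) : ℝ) := by exact_mod_cast hub
    refine h1.trans ?_
    push_cast
    gcongr
    exact Nat.floor_le (Real.exp_pos X).le
  have hlog := Real.log_le_log hT0 hub2
  rw [Real.log_mul (by positivity) (by positivity), Real.log_mul (by positivity) (by positivity),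
    Real.log_mul (by positivity) (by positivity), Real.log_mul (by positivity) (by positivity),
    Real.log_exp, Real.log_pow, Real.log_pow, hν] at hlog
  have hn0 : (0 : ℝ) ≤ n := Nat.cast_nonneg n
  have hs0 : (0 : ℝ) ≤ s := Nat.cast_nonneg s
  have k1 : Real.log ((n : ℝ) + 1) ≤ ν := by
    have := Real.log_le_sub_one_of_pos (show (0 : ℝ) < (n : ℝ) + 1 by positivity)
    linarith
  have k2 : Real.log ((N : ℝ) + 1) ≤ 2 * ν := by
    have h2N : (2 : ℝ) ≤ N := by exact_mod_cast hN
    have : Real.log ((N : ℝ) + 1) ≤ Real.log ((N : ℝ) ^ 2) :=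
      Real.log_le_log (by positivity) (by nlinarith)
    rw [Real.log_pow, hν] at this
    push_cast at this
    nlinarith
  have k3 : (n : ℝ) * Real.log ((N : ℝ) + 1) ≤ 2 * ν ^ 2 := by
    calc (n : ℝ) * Real.log ((N : ℝ) + 1) ≤ n * (2 * ν) := by gcongr
      _ ≤ ν * (2 * ν) := by gcongr
      _ = _ := by ring
  have k4 : (E : ℝ) * (Real.log 2 * ν) ≤ 24 * (h * ν ^ 2) := by
    have : (E : ℝ) ≤ 12 * (n * s) := by exact_mod_cast hEb
    calc (E : ℝ) * (Real.log 2 * ν) ≤ (12 * (n * s)) * (1 * ν) := by gcongr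
      _ ≤ (12 * (ν * (2 * h))) * (1 * ν) := by gcongr
      _ = _ := by ring
  have k5 : X ≤ Real.log 2 * (2 / 27 * ν ^ 3) + ν ^ 2 + 2 * (h * ν ^ 2) := by
    have : X = Real.log 2 * (2 / 27 * ν ^ 3) + Real.log 2 * (ν ^ 2 + s * ν ^ 2) := by
      rw [hX]; ring
    rw [this]
    have : Real.log 2 * (ν ^ 2 + s * ν ^ 2) ≤ 1 * (ν ^ 2 + (2 * h) * ν ^ 2) := by gcongr
    linarith
  have k6 : ν ≤ ν ^ 2 := by nlinarith
  have k7 : ν ^ 2 ≤ h * ν ^ 2 := le_mul_of_one_le_left (by positivity) hh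
  linarith

theorem rc_lower_real (N n : ℕ) (ν : ℝ) (hN : 2 ≤ N) (hn1 : 1 ≤ n) (hν1 : 1 ≤ ν)
    (hν : Real.log N = Real.log 2 * ν) (e1 : 2 ^ n ≤ N) (hnν : (n : ℝ) ≤ ν) (hνn : ν ≤ n + 1)
    (hfin : Finite (Quot (FinCommRingLE.Iso (N := N)))) :
    1 ≤ ringCountLE N ∧
    Real.log 2 * (2 / 27 * ν ^ 3) - 2 * ν ^ 2 ≤ Real.log (ringCountLE N) := by
  have hl : 0 < Real.log 2 := Real.log_pos (by norm_num)
  have hl1 : Real.log 2 ≤ 1 := by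
    have := Real.log_le_sub_one_of_pos (show (0 : ℝ) < 2 by norm_num)
    linarith
  obtain ⟨d, hd⟩ : ∃ d, d = 2 * (n - 1) / 3 := ⟨_, rfl⟩
  obtain ⟨r, hr⟩ : ∃ r, r = n - 1 - d := ⟨_, rfl⟩
  have hdr : 1 + d + r = n := by omega
  have hlow := rc_lower N d r (by rw [hdr]; exact e1) hfin
  rw [hdr] at hlow
  have hT : 1 ≤ ringCountLE N := by
    by_contra hcon
    have : ringCountLE N = 0 := by omega
    rw [this, zero_mul] at hlow
    have : 0 < (2 ^ r) ^ ((d + 1).choose 2) := by positivity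
    omega
  refine ⟨hT, ?_⟩
  have hT0 : (0 : ℝ) < ringCountLE N := by exact_mod_cast hT
  have hN0 : (0 : ℝ) < N := by positivity
  have h1 : ((2 : ℝ) ^ r) ^ ((d + 1).choose 2) ≤ ringCountLE N * (N : ℝ) ^ n := by
    exact_mod_cast hlow
  have h2 := Real.log_le_log (by positivity) h1
  rw [Real.log_mul (by positivity) (by positivity), Real.log_pow, Real.log_pow, Real.log_pow,
    hν, Nat.cast_choose_two] at h2
  push_cast at h2
  have hn0 : (0 : ℝ) ≤ n := Nat.cast_nonneg n
  have g1 : (n : ℝ) * (Real.log 2 * ν) ≤ ν ^ 2 := by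
    calc (n : ℝ) * (Real.log 2 * ν) ≤ ν * (1 * ν) := by gcongr
      _ = _ := by ring
  have hd3 : 2 * (n : ℝ) ≤ 3 * d + 4 := by
    have : 2 * n ≤ 3 * d + 4 := by omega
    exact_mod_cast this
  have hr3 : (n : ℝ) ≤ 3 * r + 1 := by
    have : n ≤ 3 * r + 1 := by omega
    exact_mod_cast this
  have hd0 : (0 : ℝ) ≤ d := Nat.cast_nonneg d
  have hr0 : (0 : ℝ) ≤ r := Nat.cast_nonneg r
  have g2 : 2 / 27 * (ν ^ 3 - 8 * ν ^ 2) ≤ (d + 1 : ℝ) * (d + 1 - 1) / 2 * r := by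
    by_cases h3 : ν ≤ 3
    · have : 2 / 27 * (ν ^ 3 - 8 * ν ^ 2) ≤ 0 := by nlinarith [sq_nonneg ν]
      refine this.trans ?_
      have : (d + 1 : ℝ) - 1 = d := by ring
      rw [this]
      positivity
    · push Not at h3
      have a1 : (2 * ν - 6) / 3 ≤ d := by linarith
      have a2 : (ν - 2) / 3 ≤ r := by linarith
      have a3 : ((2 * ν - 6) / 3) ^ 2 ≤ (d : ℝ) ^ 2 := pow_le_pow_left₀ (by linarith) a1 2
      have a4 : ((2 * ν - 6) / 3) ^ 2 * ((ν - 2) / 3) ≤ (d : ℝ) ^ 2 * r :=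
        mul_le_mul a3 a2 (by linarith) (by positivity)
      nlinarith [mul_nonneg hd0 hr0]
  have g3 := mul_le_mul_of_nonneg_left g2 hl.le
  have g4 : Real.log 2 * ν ^ 2 ≤ 1 * ν ^ 2 := by gcongr
  have g5 : 0 ≤ ν ^ 2 := by positivity
  nlinarith

/-- There is a constant `C > 0` such that for every integer `N ≥ 2`, the number
`T(N)` of isomorphism classes of finite commutative rings of cardinality at most
`N` satisfies `|log T(N) - (2/27)(log N)³/(log 2)²| ≤ C (log N)^(8/3)`. -/
theorem stmt2 :
    ∃ C : ℝ, 0 < C ∧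
      ∀ N : ℕ, 2 ≤ N →
        |Real.log (ringCountLE N) - (2 / 27 : ℝ) * (Real.log N) ^ 3 / (Real.log 2) ^ 2|
          ≤ C * (Real.log N) ^ ((8 : ℝ) / 3) := by
  have hl : 0 < Real.log 2 := Real.log_pos (by norm_num)
  refine ⟨40 / (Real.log 2) ^ ((8 : ℝ) / 3), by positivity, fun N hN => ?_⟩
  obtain ⟨n, s, ν, h, hn1, hs1, hν1, hν, e1, e2, hnν, hνn, hs, hk, hh, hsq, hsh⟩ := rc_params N hN
  have hfin := (rc_upper N n s (2 * s) _ e2 hs hk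
    (fun a _ c hc h => rc_tableBound N n s ν hν hν1 hs1 hN a c hc h)).1
  obtain ⟨hT, hlow⟩ := rc_lower_real N n ν hN hn1 hν1 hν e1 hnν hνn hfin
  have hup := rc_upper_real N n s ν h hN hn1 hs1 hν1 hν e2 hnν hs hk hh hsq hsh hT
  have hν0 : 0 ≤ ν := by linarith
  have main : (2 / 27 : ℝ) * (Real.log N) ^ 3 / (Real.log 2) ^ 2
      = Real.log 2 * (2 / 27 * ν ^ 3) := by
    rw [hν]; field_simp
  have hrp : 40 / (Real.log 2) ^ ((8 : ℝ) / 3) * (Real.log N) ^ ((8 : ℝ) / 3)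
      = 40 * ν ^ ((8 : ℝ) / 3) := by
    rw [hν, Real.mul_rpow hl.le hν0]
    have : (Real.log 2) ^ ((8 : ℝ) / 3) ≠ 0 := by positivity
    field_simp
  have hpow : h * ν ^ 2 ≤ ν ^ ((8 : ℝ) / 3) := by
    have hs1 : h = ν ^ ((1 : ℝ) / 2) := by
      rw [← Real.sqrt_eq_rpow, ← hsq, Real.sqrt_sq (by linarith)]
    have hs2 : h * ν ^ 2 = ν ^ ((5 : ℝ) / 2) := by
      rw [hs1, ← Real.rpow_natCast ν 2, ← Real.rpow_add (by linarith)]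
      norm_num
    rw [hs2]
    exact Real.rpow_le_rpow_of_exponent_le hν1 (by norm_num)
  have hge : ν ^ 2 ≤ h * ν ^ 2 := le_mul_of_one_le_left (by positivity) hh
  rw [main, hrp, abs_le]
  have : 0 ≤ ν ^ 2 := by positivity
  constructor <;> linarith
end
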